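/- arXiv:2003.03639 — 2 statements merged into one kernel-verified Lean document; each statement's English description precedes it below -/
import Mathlib

section
/- For every m ≥ 3, every m-weak-double-cycle has exactly m + 2 cycles, i.e., exactly m + 2 subdigraphs that are isomorphic to a cycle digraph. -/
/-- A literal: a variable (a natural number) together with a polarity. -/
abbrev Lit : Type := ℕ × Bool

/-- Complementation of literals: a fixed-point-free involution. -/
def Lit.compl (x : Lit) : Lit := (x.1, !x.2)

/-- The set of variables occurring in a clause-set. -/
def varsOf (F : Finset (Finset Lit)) : Finset ℕ := F.biUnion (fun C => C.image Prod.fst)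

/-- The literals over the variables of `F` (both polarities). -/
def litsOf (F : Finset (Finset Lit)) : Finset Lit := varsOf F ×ˢ (Finset.univ : Finset Bool)

/-- A clause is clash-free. -/
def IsClause (C : Finset Lit) : Prop := ∀ x ∈ C, Lit.compl x ∉ C

/-- A clause-set consists of clauses. -/
def IsClauseSet (F : Finset (Finset Lit)) : Prop := ∀ C ∈ F, IsClause C

/-- The truth value of a literal under a total assignment. -/
def LitVal (φ : ℕ → Bool) (x : Lit) : Bool := if x.2 then φ x.1 else !(φ x.1)

/-- Satisfiability of a clause-set. -/
def Sat (F : Finset (Finset Lit)) : Prop := ∃ φ : ℕ → Bool, ∀ C ∈ F, ∃ x ∈ C, LitVal φ x = true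

/-- Minimal unsatisfiability. -/
def MU (F : Finset (Finset Lit)) : Prop := IsClauseSet F ∧ ¬ Sat F ∧ ∀ G ⊂ F, Sat G

/-- Minimally unsatisfiable 2-clause-set. -/
def MU2 (F : Finset (Finset Lit)) : Prop := MU F ∧ ∀ C ∈ F, C.card ≤ 2

/-- The deficiency δ(F) = c(F) - n(F). -/
def deficiency (F : Finset (Finset Lit)) : ℤ := (F.card : ℤ) - ((varsOf F).card : ℤ)

/-- Literal-degree: number of clauses containing the literal. -/
def ldeg (F : Finset (Finset Lit)) (x : Lit) : ℕ := (F.filter (fun C => x ∈ C)).card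

/-- Variable-degree. -/
def vdeg (F : Finset (Finset Lit)) (v : ℕ) : ℕ := ldeg F (v, true) + ldeg F (v, false)

/-- Isomorphism of clause-sets: a bijection between the literals over the variables,
commuting with complementation, mapping one clause-set onto the other. -/
def CNFIso (F F' : Finset (Finset Lit)) (f : Lit → Lit) : Prop :=
  Set.BijOn f ↑(litsOf F) ↑(litsOf F') ∧
  (∀ x ∈ litsOf F, f (Lit.compl x) = Lit.compl (f x)) ∧
  F.image (fun C => C.image f) = F'

/-- A digraph: a finite vertex set and a finite set of arcs. -/
structure FinDigraph (α : Type) where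
  V : Finset α
  E : Finset (α × α)

/-- Well-formedness of a digraph: arcs join distinct vertices. -/
def FinDigraph.WellFormed {α : Type} (G : FinDigraph α) : Prop :=
  ∀ p ∈ G.E, p.1 ∈ G.V ∧ p.2 ∈ G.V ∧ p.1 ≠ p.2

/-- `f` is an isomorphism of digraphs from `G` to `G'`. -/
def DigraphIso {α β : Type} [DecidableEq β] (G : FinDigraph α) (G' : FinDigraph β) (f : α → β) : Prop :=
  Set.BijOn f ↑G.V ↑G'.V ∧ G.E.image (fun p => (f p.1, f p.2)) = G'.E

/-- The implication digraph of a 2-clause-set (without the empty clause):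
vertices are the literals over the variables of `F`, and there is an arc `(a,b)` iff
`{compl a} ∪ {b}` is a clause of `F` (this yields `(x̄,y),(ȳ,x)` for a clause `{x,y}`
and `(x̄,x)` for a unit-clause `{x}`). -/
def idg (F : Finset (Finset Lit)) : FinDigraph Lit :=
  ⟨litsOf F, (litsOf F ×ˢ litsOf F).filter (fun p => insert (Lit.compl p.1) {p.2} ∈ F)⟩

def FinDigraph.inDeg {α : Type} [DecidableEq α] (G : FinDigraph α) (v : α) : ℕ :=
  (G.E.filter (fun p => p.2 = v)).card

def FinDigraph.outDeg {α : Type} [DecidableEq α] (G : FinDigraph α) (v : α) : ℕ :=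
  (G.E.filter (fun p => p.1 = v)).card

/-- The standard double `m`-cycle. -/
def stdDoubleCycle (m : ℕ) : FinDigraph ℕ :=
  ⟨Finset.range m, (Finset.range m).biUnion (fun i => {(i, (i+1) % m), ((i+1) % m, i)})⟩

/-- A double `m`-cycle (`m ≥ 3`). -/
def IsDoubleCycle {α : Type} [DecidableEq α] (m : ℕ) (G : FinDigraph α) : Prop :=
  3 ≤ m ∧ ∃ f : ℕ → α, DigraphIso (stdDoubleCycle m) G f

/-- Splitting a vertex `x` into `u`, `v` with a new arc `(u,v)`:
arcs into `x` now go into `u`, arcs out of `x` now leave `v`. -/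
def SplitVertex {α : Type} [DecidableEq α] (G G' : FinDigraph α) : Prop :=
  ∃ x u v, x ∈ G.V ∧ u ∉ G.V ∧ v ∉ G.V ∧ u ≠ v ∧
    G'.V = insert u (insert v (G.V.erase x)) ∧
    G'.E = insert (u, v)
      ((G.E.filter (fun p => p.1 ≠ x ∧ p.2 ≠ x)) ∪
       ((G.E.filter (fun p => p.2 = x)).image (fun p => (p.1, u))) ∪
       ((G.E.filter (fun p => p.1 = x)).image (fun p => (v, p.2))))

/-- Splitting an arc `(x,y)` by a new (linear) vertex `v`. -/
def SplitArc {α : Type} [DecidableEq α] (G G' : FinDigraph α) : Prop :=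
  ∃ x y v, (x, y) ∈ G.E ∧ v ∉ G.V ∧
    G'.V = insert v G.V ∧
    G'.E = insert (x, v) (insert (v, y) (G.E.erase (x, y)))

/-- An `m`-weak-double-cycle: obtained from a double `m`-cycle by a finite sequence
of vertex splittings and arc splittings. -/
def IsWDC {α : Type} [DecidableEq α] (m : ℕ) (G : FinDigraph α) : Prop :=
  ∃ G₀ : FinDigraph α, IsDoubleCycle m G₀ ∧
    Relation.ReflTransGen (fun A B => SplitVertex A B ∨ SplitArc A B) G₀ G

/-- A digraph is nonlinear if no vertex has in-degree 1 and out-degree 1. -/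
def FinDigraph.Nonlinear {α : Type} [DecidableEq α] (G : FinDigraph α) : Prop :=
  ∀ v ∈ G.V, ¬ (G.inDeg v = 1 ∧ G.outDeg v = 1)

/-- Strong connectivity. -/
def StronglyConnected {α : Type} (G : FinDigraph α) : Prop :=
  ∀ a ∈ G.V, ∀ b ∈ G.V, Relation.ReflTransGen (fun x y => (x, y) ∈ G.E) a b

/-- A cycle digraph: strongly connected, at least 2 vertices, all vertices linear. -/
def IsCycleDigraph {α : Type} [DecidableEq α] (G : FinDigraph α) : Prop :=
  G.WellFormed ∧ 2 ≤ G.V.card ∧ StronglyConnected G ∧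
    ∀ v ∈ G.V, G.inDeg v = 1 ∧ G.outDeg v = 1

/-- A skew-symmetry of a digraph, as a permutation of its vertex set:
a fixed-point-free involution reversing arcs. -/
def IsSkewSym {α : Type} (G : FinDigraph α) (σ : Equiv.Perm {x // x ∈ G.V}) : Prop :=
  (∀ v, σ (σ v) = v) ∧ (∀ v, σ v ≠ v) ∧
  ∀ a b : {x // x ∈ G.V}, ((a : α), (b : α)) ∈ G.E → (((σ b : α)), ((σ a : α))) ∈ G.E

/-- A skew-symmetry has a unit if some vertex is joined by an arc to its image. -/
def HasUnit {α : Type} (G : FinDigraph α) (σ : Equiv.Perm {x // x ∈ G.V}) : Prop :=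
  ∃ v : {x // x ∈ G.V}, ((v : α), ((σ v : α))) ∈ G.E

/-- The literals over the variables of `F` are closed under complementation. -/
lemma compl_mem {F : Finset (Finset Lit)} {x : Lit} (h : x ∈ litsOf F) :
    Lit.compl x ∈ litsOf F := by
  simp only [litsOf, Lit.compl, Finset.mem_product] at h ⊢
  exact ⟨h.1, Finset.mem_univ _⟩

/-- Clause-set isomorphism, as an equivalence between the literals over the variables. -/
def CNFIsoE (F F' : Finset (Finset Lit))
    (e : {x // x ∈ litsOf F} ≃ {x // x ∈ litsOf F'}) : Prop :=
  (∀ x : {x // x ∈ litsOf F}, (e ⟨Lit.compl x.1, compl_mem x.2⟩ : Lit) = Lit.compl (e x : Lit)) ∧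
  F.image (fun C => C.image (fun y =>
      if h : y ∈ litsOf F then ((e ⟨y, h⟩ : {x // x ∈ litsOf F'}) : Lit) else y)) = F'

/-- An automorphism of a digraph, as a permutation of its vertex set preserving arcs. -/
def FinDigraphAut {α : Type} (G : FinDigraph α) (π : Equiv.Perm {x // x ∈ G.V}) : Prop :=
  ∀ a b : {x // x ∈ G.V}, ((a : α), (b : α)) ∈ G.E ↔ ((π a : α), (π b : α)) ∈ G.E

/-- Multiplicity of the edge between `u` and `v` in the underlying multigraph of a digraph. -/
def mult {α : Type} [DecidableEq α] (G : FinDigraph α) (u v : α) : ℕ :=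
  (if (u, v) ∈ G.E then 1 else 0) + (if (v, u) ∈ G.E then 1 else 0)

/-- `f` is an isomorphism between the underlying multigraphs of two digraphs. -/
def MultigraphIso {α β : Type} [DecidableEq α] [DecidableEq β]
    (G : FinDigraph α) (G' : FinDigraph β) (f : α → β) : Prop :=
  Set.BijOn f ↑G.V ↑G'.V ∧ ∀ u ∈ G.V, ∀ v ∈ G.V, mult G u v = mult G' (f u) (f v)

/-- `f` is an isomorphism between the underlying graphs of two digraphs. -/
def GraphIso {α β : Type} (G : FinDigraph α) (G' : FinDigraph β) (f : α → β) : Prop :=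
  Set.BijOn f ↑G.V ↑G'.V ∧ ∀ u ∈ G.V, ∀ v ∈ G.V,
    (((u, v) ∈ G.E ∨ (v, u) ∈ G.E) ↔ ((f u, f v) ∈ G'.E ∨ (f v, f u) ∈ G'.E))

/-- The transpose of a digraph: all arcs reversed. -/
def FinDigraph.transpose {α : Type} [DecidableEq α] (G : FinDigraph α) : FinDigraph α :=
  ⟨G.V, G.E.image (fun p => (p.2, p.1))⟩

/-- DP-reduction on variable `v`: replace all clauses containing `v` or `v̄` by all
their non-tautological resolvents on `v`. -/
def DP (v : ℕ) (F : Finset (Finset Lit)) : Finset (Finset Lit) :=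
  (F.filter (fun C => (v, true) ∉ C ∧ (v, false) ∉ C)) ∪
  ((((F.filter (fun C => (v, true) ∈ C)) ×ˢ (F.filter (fun C => (v, false) ∈ C))).image
      (fun p => (p.1.erase (v, true)) ∪ (p.2.erase (v, false)))).filter
    (fun C => ∀ x ∈ C, Lit.compl x ∉ C))

/-- A variable is singular if one of its literals has literal-degree 1. -/
def Singular (F : Finset (Finset Lit)) (v : ℕ) : Prop :=
  ldeg F (v, true) = 1 ∨ ldeg F (v, false) = 1

/-- The "middle part" `M_n = {{v̄_1,v_2},…,{v̄_{n−1},v_n}}`, with variables `1,…,n`. -/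
def Mn (n : ℕ) : Finset (Finset Lit) :=
  (Finset.Icc 1 (n - 1)).image (fun i => ({(i, false), (i + 1, true)} : Finset Lit))

def famU2 (n : ℕ) : Finset (Finset Lit) :=
  Mn n ∪ {({((1 : ℕ), true)} : Finset Lit), ({((n : ℕ), false)} : Finset Lit)}

def famU1 (n i : ℕ) : Finset (Finset Lit) :=
  Mn n ∪ {({((1 : ℕ), true)} : Finset Lit), ({((n : ℕ), false), ((i : ℕ), false)} : Finset Lit)}

def famU0s (n i : ℕ) : Finset (Finset Lit) :=
  Mn n ∪ {({((1 : ℕ), true), ((i : ℕ), true)} : Finset Lit),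
          ({((n : ℕ), false), ((i : ℕ), false)} : Finset Lit)}

def famU0 (n x y : ℕ) : Finset (Finset Lit) :=
  Mn n ∪ {({((1 : ℕ), true), ((x : ℕ), true)} : Finset Lit),
          ({((n : ℕ), false), ((y : ℕ), false)} : Finset Lit)}

/-- Membership in one of the four families (with the stated parameter ranges). -/
def InFam (G : Finset (Finset Lit)) : Prop :=
  (∃ n, 1 ≤ n ∧ G = famU2 n) ∨
  (∃ n i, 2 ≤ n ∧ 1 ≤ i ∧ i ≤ n - 1 ∧ G = famU1 n i) ∨
  (∃ n i, 3 ≤ n ∧ 2 ≤ i ∧ 2 * i ≤ n + 1 ∧ G = famU0s n i) ∨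
  (∃ n x y, 4 ≤ n ∧ 2 ≤ x ∧ x < y ∧ y ≤ n - 1 ∧ x + y ≤ n + 1 ∧ G = famU0 n x y)

/-- The number of unit-clauses of `F`. -/
def unitCount (F : Finset (Finset Lit)) : ℕ := (F.filter (fun C => C.card = 1)).card

/-- MU 2-clause-sets of deficiency `k` with exactly `n` variables. -/
def MU2dn (k : ℤ) (n : ℕ) : Type :=
  {F : Finset (Finset Lit) // MU2 F ∧ deficiency F = k ∧ (varsOf F).card = n}

/-- Isomorphism relation on `MU2dn k n`. -/
def isoRel {k : ℤ} {n : ℕ} (F F' : MU2dn k n) : Prop := ∃ f, CNFIso F.1 F'.1 f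

/-- The number of isomorphism classes of MU 2-clause-sets of deficiency `k`
with exactly `n` variables. -/
noncomputable def numClasses (k : ℤ) (n : ℕ) : ℕ := Nat.card (Quot (@isoRel k n))

/-- Equivalence of binary bracelets of length `m`: rotations and reflections of the
cyclic index set. -/
def BraceletRel (m : ℕ) (b b' : ZMod m → Bool) : Prop :=
  ∃ (r : ZMod m) (s : Bool), ∀ i, b' i = b (if s then r - i else i + r)

/-- Digraph-isomorphism relation on nonlinear `m`-WDCs. -/
def NonlinWDCRel (m : ℕ) (G G' : {G : FinDigraph ℕ // IsWDC m G ∧ G.Nonlinear}) : Prop :=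
  ∃ f : ℕ → ℕ, DigraphIso G.1 G'.1 f

/-- `H` is a subdigraph of `G`. -/
def Subdigraph {α : Type} (H G : FinDigraph α) : Prop := H.V ⊆ G.V ∧ H.E ⊆ G.E

/-- The cyclic permutations all of whose moves follow the relation `R`. -/
def cyclePerms {α : Type*} (R : α → α → Prop) : Set (Equiv.Perm α) :=
  {σ | σ.IsCycle ∧ ∀ x, σ x ≠ x → R x (σ x)}

lemma Equiv.Perm.sameCycle_of_forall_sameCycle_apply {α : Type*} {σ τ : Equiv.Perm α}
    (h : ∀ x, τ.SameCycle x (σ x)) {a b : α} (hab : σ.SameCycle a b) : τ.SameCycle a b := by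
  obtain ⟨n, rfl⟩ := hab
  induction n with
  | zero => exact Equiv.Perm.SameCycle.refl _ _
  | succ n ih =>
    rw [add_comm, zpow_add, zpow_one, Equiv.Perm.mul_apply]
    exact ih.trans (h _)
  | pred n ih =>
    refine ih.trans ?_
    have := (h ((σ ^ (-(n : ℤ) - 1)) a)).symm
    rwa [← Equiv.Perm.mul_apply, ← zpow_one_add,
      show 1 + (-(n : ℤ) - 1) = -n by ring] at this

lemma Equiv.Perm.isCycle_mul_swap_iff {α : Type*} [DecidableEq α] {σ : Equiv.Perm α} {u v : α}
    (huv : u ≠ v) (hv : σ v = v) (hu : σ u ≠ u) :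
    (σ * Equiv.swap u v).IsCycle ↔ σ.IsCycle := by
  have hτu : (σ * Equiv.swap u v) u = v := by simp [hv]
  have hτv : (σ * Equiv.swap u v) v = σ u := by simp
  have hτ : ∀ x, x ≠ u → x ≠ v → (σ * Equiv.swap u v) x = σ x := fun x h1 h2 => by
    simp [Equiv.swap_apply_of_ne_of_ne h1 h2]
  have hσu : σ u ≠ v := fun e => huv (σ.injective (e.trans hv.symm))
  have hmul : Equiv.swap v (σ u) * (σ * Equiv.swap u v) = σ := by
    rw [← mul_assoc, Equiv.swap_comm v, ← hv, ← Equiv.mul_swap_eq_swap_mul]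
    simp [hv, mul_assoc]
  generalize σ * Equiv.swap u v = τ at *
  constructor
  · intro h
    have := h.swap_mul (x := v) (by rwa [hτv])
      (by rw [hτv, hτ _ hu hσu]; exact fun e => hσu (σ.injective (e.trans hv.symm)))
    rwa [hτv, hmul] at this
  · intro h
    refine ⟨u, by rw [hτu]; exact huv.symm, fun y hy => ?_⟩
    by_cases hyv : y = v
    · exact ⟨1, by simp [hτu, hyv]⟩
    refine Equiv.Perm.sameCycle_of_forall_sameCycle_apply (σ := σ) (fun x => ?_)
      (h.sameCycle hu ?_)
    · by_cases hxu : x = u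
      · exact ⟨2, by simp [pow_two, hxu, hτu, hτv, zpow_ofNat]⟩
      by_cases hxv : x = v
      · exact ⟨0, by simp [hxv, hv]⟩
      · exact ⟨1, by simp [hτ x hxu hxv]⟩
    · by_cases hyu : y = u
      · rwa [hyu]
      · rwa [← hτ y hyu hyv]

/-- Inserting a vertex `v` behind `u`, where each arc out of `u` may be moved to `v`, does not
change the number of cycles. -/
lemma ncard_cyclePerms_split {α : Type*} {R R' : α → α → Prop} {u v : α}
    (huv : u ≠ v) (h1 : ∀ a, R' a v ↔ a = u)
    (h2 : ∀ a b, a ≠ u → a ≠ v → b ≠ v → (R' a b ↔ R a b))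
    (h3 : ∀ b, b ≠ v → (R u b ↔ R' u b ∨ R' v b))
    (h4 : ∀ b, b ≠ v → ¬ (R' u b ∧ R' v b))
    (h5 : ∀ a, ¬ R v a) (h6 : ¬ R u u) :
    (cyclePerms R').ncard = (cyclePerms R).ncard := by
  classical
  have hvu : ¬ R' v u := fun h => h6 ((h3 u huv).2 (Or.inr h))
  symm
  refine Set.ncard_congr (fun σ _ => if R' v (σ u) then σ * Equiv.swap u v else σ) ?_ ?_ ?_
  · rintro σ ⟨hc, hσ⟩
    have hv : σ v = v := by_contra fun h => h5 _ (hσ v h)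
    have hne : ∀ x, x ≠ v → σ x ≠ v := fun x hx h => hx (σ.injective (h.trans hv.symm))
    split_ifs with h
    · have hu : σ u ≠ u := fun e => hvu (by rwa [e] at h)
      refine ⟨(Equiv.Perm.isCycle_mul_swap_iff huv hv hu).2 hc, fun x hx => ?_⟩
      by_cases hxu : x = u
      · subst hxu; simp [hv, h1]
      by_cases hxv : x = v
      · subst hxv; simpa using h
      · simp only [Equiv.Perm.mul_apply, Equiv.swap_apply_of_ne_of_ne hxu hxv] at hx ⊢
        exact (h2 _ _ hxu hxv (hne x hxv)).2 (hσ x hx)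
    · refine ⟨hc, fun x hx => ?_⟩
      have hxv : x ≠ v := by rintro rfl; exact hx hv
      by_cases hxu : x = u
      · subst hxu
        exact ((h3 _ (hne x hxv)).1 (hσ x hx)).resolve_right h
      · exact (h2 _ _ hxu hxv (hne x hxv)).2 (hσ x hx)
  · rintro σ τ ⟨-, hσ⟩ ⟨-, hτ⟩ h
    have hv : σ v = v := by_contra fun h => h5 _ (hσ v h)
    have hv' : τ v = v := by_contra fun h => h5 _ (hτ v h)
    split_ifs at h with ha hb hb
    · exact mul_right_cancel h
    · have := congrArg (fun ρ : Equiv.Perm α => ρ u) h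
      simp only [Equiv.Perm.mul_apply, Equiv.swap_apply_left] at this
      exact absurd (τ.injective (hv'.trans (hv.symm.trans this))) huv.symm
    · have := congrArg (fun ρ : Equiv.Perm α => ρ u) h
      simp only [Equiv.Perm.mul_apply, Equiv.swap_apply_left] at this
      exact absurd (σ.injective (this.trans (hv'.trans hv.symm))) huv
    · exact h
  · rintro τ ⟨hc, hτ⟩
    by_cases hv : τ v = v
    · have hne : ∀ x, x ≠ v → τ x ≠ v := fun x hx h => hx (τ.injective (h.trans hv.symm))
      refine ⟨τ, ⟨hc, fun x hx => ?_⟩, if_neg fun h => ?_⟩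
      · have hxv : x ≠ v := by rintro rfl; exact hx hv
        by_cases hxu : x = u
        · subst hxu
          exact (h3 _ (hne x hxv)).2 (Or.inl (hτ x hx))
        · exact (h2 _ _ hxu hxv (hne x hxv)).1 (hτ x hx)
      · by_cases hu : τ u = u
        · exact hvu (by rwa [hu] at h)
        · exact h4 _ (hne u huv) ⟨hτ u hu, h⟩
    · have hu : τ u = v := by
        have := hτ (τ.symm v) (by
          rw [Equiv.apply_symm_apply]
          intro h
          exact hv (by conv_lhs => rw [h, Equiv.apply_symm_apply]))
        rw [Equiv.apply_symm_apply, h1] at this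
        rw [← this, Equiv.apply_symm_apply]
      have hw : R' v (τ v) := hτ v hv
      have hwu : τ v ≠ u := fun h => hvu (by rwa [h] at hw)
      have hσv : (τ * Equiv.swap u v) v = v := by simp [hu]
      have hσu : (τ * Equiv.swap u v) u = τ v := by simp
      have hτσ : τ * Equiv.swap u v * Equiv.swap u v = τ := by simp [mul_assoc]
      refine ⟨τ * Equiv.swap u v, ⟨?_, fun x hx => ?_⟩, (if_pos (by rwa [hσu])).trans hτσ⟩
      · rw [← Equiv.Perm.isCycle_mul_swap_iff huv hσv (by rwa [hσu]), hτσ]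
        exact hc
      · have hxv : x ≠ v := by rintro rfl; exact hx hσv
        by_cases hxu : x = u
        · subst hxu
          rw [hσu]
          exact (h3 _ hv).2 (Or.inr hw)
        · simp only [Equiv.Perm.mul_apply, Equiv.swap_apply_of_ne_of_ne hxu hxv] at hx ⊢
          exact (h2 _ _ hxu hxv fun h => hxu (τ.injective (h.trans hu.symm))).1 (hτ x hx)

/-- Embedding a relation into a larger type does not change the number of cycles. -/
lemma ncard_cyclePerms_map {α β : Type*} (R : α → α → Prop) {g : α → β}
    (hg : Function.Injective g) :
    (cyclePerms (Relation.Map R g g)).ncard = (cyclePerms R).ncard := by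
  classical
  let e : α ≃ {y // y ∈ Set.range g} := Equiv.ofInjective g hg
  have he : ∀ a, (e a : β) = g a := fun a => rfl
  symm
  refine Set.ncard_congr (fun σ _ => σ.extendDomain e) ?_ ?_ ?_
  · rintro σ ⟨hc, hσ⟩
    refine ⟨hc.extendDomain e, fun x hx => ?_⟩
    by_cases hx' : x ∈ Set.range g
    · obtain ⟨a, rfl⟩ := hx'
      have := Equiv.Perm.extendDomain_apply_image σ e a
      rw [he, he] at this
      rw [this] at hx ⊢
      exact ⟨a, σ a, hσ a fun h => hx (by rw [h]), rfl, rfl⟩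
    · exact absurd (Equiv.Perm.extendDomain_apply_not_subtype σ e hx') hx
  · intro σ τ _ _ h
    exact Equiv.Perm.extendDomainHom_injective e h
  · rintro τ ⟨hc, hτ⟩
    have hmem : ∀ x, x ∈ Set.range g ↔ τ x ∈ Set.range g := by
      intro x
      by_cases hx : τ x = x
      · rw [hx]
      · obtain ⟨a, b, -, h1, h2⟩ := hτ x hx
        exact ⟨fun _ => ⟨b, h2⟩, fun _ => ⟨a, h1⟩⟩
    let σ : Equiv.Perm α := e.permCongr.symm (τ.subtypePerm fun x => (hmem x).symm)
    have hσ : ∀ a, g (σ a) = τ (g a) := by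
      intro a
      rw [← he]
      simp [σ, Equiv.permCongr, he]
    have hext : σ.extendDomain e = τ := by
      ext x
      by_cases hx : x ∈ Set.range g
      · obtain ⟨a, rfl⟩ := hx
        rw [← hσ, ← he, ← he, Equiv.Perm.extendDomain_apply_image]
      · rw [Equiv.Perm.extendDomain_apply_not_subtype σ e hx]
        by_contra h
        obtain ⟨a, b, -, h1, h2⟩ := hτ x (Ne.symm h)
        exact hx ⟨a, h1⟩
    refine ⟨σ, ⟨?_, fun a ha => ?_⟩, hext⟩
    · obtain ⟨x, hx, hc⟩ := hc
      obtain ⟨a, -, -, rfl, -⟩ := hτ x hx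
      refine ⟨a, fun h => hx (by rw [← hσ, h]), fun b hb => ?_⟩
      have := hc (y := g b) (by rw [← hσ]; exact fun h => hb (hg h))
      rwa [← hext, ← he, ← he, Equiv.Perm.sameCycle_extendDomain] at this
    · obtain ⟨b, c, hbc, h1, h2⟩ := hτ (g a) (by rw [← hσ]; exact fun h => ha (hg h))
      rw [← hσ] at h2
      rwa [hg h1, hg h2] at hbc

/-- The double cycle on `ZMod m` has exactly the two rotations and the `m` digons as cycles. -/
lemma ncard_cyclePerms_zmod (m : ℕ) (hm : 3 ≤ m) :
    (cyclePerms fun i j : ZMod m => j = i + 1 ∨ i = j + 1).ncard = m + 2 := by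
  have : NeZero m := ⟨by omega⟩
  have : Fact (1 < m) := ⟨by omega⟩
  have h2 : (2 : ZMod m) ≠ 0 := by
    intro h
    have := (ZMod.natCast_eq_zero_iff 2 m).1 (by exact_mod_cast h)
    exact absurd (Nat.le_of_dvd (by norm_num) this) (by omega)
  have h1 : (1 : ZMod m) ≠ 0 := one_ne_zero
  have hinj : Function.Injective fun i : ZMod m => Equiv.swap i (i + 1) := by
    intro i j h
    have h' := congrArg (fun ρ : Equiv.Perm (ZMod m) => ρ i) h
    simp only [Equiv.swap_apply_left] at h'
    rw [Equiv.swap_apply_def] at h'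
    split_ifs at h' with ha hb
    · exact ha
    · exact absurd (by linear_combination h' - hb) h2
    · exact absurd (by linear_combination h') h1
  have hpow : ∀ (c : ZMod m) (n : ℕ) i, ((Equiv.addRight c) ^ n) i = i + n * c := by
    intro c n i
    induction n with
    | zero => simp
    | succ n ih => rw [pow_succ', Equiv.Perm.mul_apply, ih]; simp; ring
  have hset : (cyclePerms fun i j : ZMod m => j = i + 1 ∨ i = j + 1) =
      insert (Equiv.addRight 1) (insert (Equiv.addRight (-1))
        (Set.range fun i : ZMod m => Equiv.swap i (i + 1))) := by
    ext σ
    simp only [Set.mem_insert_iff, Set.mem_range]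
    constructor
    · rintro ⟨hc, hσ⟩
      by_cases hsw : ∃ i, σ i = i + 1 ∧ σ (i + 1) = i
      · obtain ⟨i, hi, hi'⟩ := hsw
        right; right
        refine ⟨i, ?_⟩
        rw [hc.eq_swap_of_apply_apply_eq_self (x := i) (by simp [hi, h1]) (by rw [hi, hi']), hi]
      push Not at hsw
      have hup : ∀ i, σ i = i + 1 → σ (i + 1) = i + 1 + 1 := by
        intro i hi
        have hne : σ (i + 1) ≠ i + 1 := fun h =>
          h1 (by linear_combination σ.injective (h.trans hi.symm))
        rcases hσ _ hne with h | h
        · exact h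
        · exact absurd (by linear_combination -h) (hsw i hi)
      have hdown : ∀ i, i = σ i + 1 → i - 1 = σ (i - 1) + 1 := by
        intro i hi
        have hi' : σ i = i - 1 := by linear_combination -hi
        have hne : σ (i - 1) ≠ i - 1 := fun h =>
          h1 (by linear_combination - σ.injective (h.trans hi'.symm))
        rcases hσ _ hne with h | h
        · exact absurd (show σ (i - 1 + 1) = i - 1 by rw [sub_add_cancel, hi']) (hsw (i - 1) h)
        · exact h
      obtain ⟨x, hx, -⟩ := hc
      rcases hσ x hx with h | h
      · left
        have key : ∀ n : ℕ, σ (x + n) = x + n + 1 := by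
          intro n
          induction n with
          | zero => simpa using h
          | succ n ih => push_cast; rw [← add_assoc]; exact hup _ ih
        ext1 i
        have := key (i - x).val
        rw [ZMod.natCast_zmod_val, add_sub_cancel] at this
        simpa using this
      · right; left
        have key : ∀ n : ℕ, x - n = σ (x - n) + 1 := by
          intro n
          induction n with
          | zero => simpa using h
          | succ n ih => push_cast; rw [← sub_sub]; exact hdown _ ih
        ext1 i
        have := key (x - i).val
        rw [ZMod.natCast_zmod_val, sub_sub_cancel] at this
        simp only [Equiv.coe_addRight]
        linear_combination -this
    · rintro (rfl | rfl | ⟨i, rfl⟩)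
      · refine ⟨⟨0, by simp, fun y _ => ⟨(y.val : ℕ), ?_⟩⟩, by simp⟩
        rw [zpow_natCast, hpow]; simp
      · refine ⟨⟨0, by simp, fun y _ => ⟨((-y).val : ℕ), ?_⟩⟩, by simp⟩
        rw [zpow_natCast, hpow, ZMod.natCast_zmod_val]; simp
      · refine ⟨Equiv.Perm.isCycle_swap (by simp), fun x hx => ?_⟩
        rw [Equiv.swap_apply_def] at hx ⊢
        split_ifs at hx ⊢ with ha hb
        · exact Or.inl (by rw [ha])
        · exact Or.inr hb
        · exact absurd rfl hx
  have hn2 : Equiv.addRight (-1 : ZMod m) ∉ Set.range fun i : ZMod m => Equiv.swap i (i + 1) := by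
    rintro ⟨i, h⟩
    have := congrArg (fun ρ : Equiv.Perm (ZMod m) => ρ i) h
    simp only [Equiv.swap_apply_left, Equiv.coe_addRight] at this
    exact h2 (by linear_combination this)
  have hn1 : Equiv.addRight (1 : ZMod m) ∉ insert (Equiv.addRight (-1 : ZMod m))
      (Set.range fun i : ZMod m => Equiv.swap i (i + 1)) := by
    rintro (h | ⟨i, h⟩)
    · have := congrArg (fun ρ : Equiv.Perm (ZMod m) => ρ 0) h
      simp only [Equiv.coe_addRight] at this
      exact h2 (by linear_combination this)
    · have := congrArg (fun ρ : Equiv.Perm (ZMod m) => ρ (i + 1)) h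
      simp only [Equiv.swap_apply_right, Equiv.coe_addRight] at this
      exact h2 (by linear_combination -this)
  rw [hset, Set.ncard_insert_of_notMem hn1, Set.ncard_insert_of_notMem hn2, ← Set.image_univ,
    Set.ncard_image_of_injective _ hinj, Set.ncard_univ, Nat.card_zmod]

lemma FinDigraph.outDeg_eq_one_iff {α : Type} [DecidableEq α] {G : FinDigraph α} {x : α} :
    G.outDeg x = 1 ↔ ∃! y, (x, y) ∈ G.E := by
  rw [FinDigraph.outDeg, Finset.card_eq_one]
  constructor
  · rintro ⟨⟨a, y⟩, h⟩
    simp only [Finset.ext_iff, Finset.mem_filter, Finset.mem_singleton, Prod.forall,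
      Prod.mk.injEq] at h
    obtain ⟨h1, rfl⟩ := (h a y).2 ⟨rfl, rfl⟩
    exact ⟨y, h1, fun z hz => ((h _ z).1 ⟨hz, rfl⟩).2⟩
  · rintro ⟨y, hy, h⟩
    refine ⟨(x, y), ?_⟩
    ext ⟨a, b⟩
    simp only [Finset.mem_filter, Finset.mem_singleton, Prod.mk.injEq]
    constructor
    · rintro ⟨hab, rfl⟩
      exact ⟨rfl, h _ hab⟩
    · rintro ⟨rfl, rfl⟩
      exact ⟨hy, rfl⟩

lemma FinDigraph.inDeg_eq_one_iff {α : Type} [DecidableEq α] {G : FinDigraph α} {y : α} :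
    G.inDeg y = 1 ↔ ∃! x, (x, y) ∈ G.E := by
  rw [FinDigraph.inDeg, Finset.card_eq_one]
  constructor
  · rintro ⟨⟨x, b⟩, h⟩
    simp only [Finset.ext_iff, Finset.mem_filter, Finset.mem_singleton, Prod.forall,
      Prod.mk.injEq] at h
    obtain ⟨h1, rfl⟩ := (h x b).2 ⟨rfl, rfl⟩
    exact ⟨x, h1, fun z hz => ((h z _).1 ⟨hz, rfl⟩).1⟩
  · rintro ⟨x, hx, h⟩
    refine ⟨(x, y), ?_⟩
    ext ⟨a, b⟩
    simp only [Finset.mem_filter, Finset.mem_singleton, Prod.mk.injEq]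
    constructor
    · rintro ⟨hab, rfl⟩
      exact ⟨h _ hab, rfl⟩
    · rintro ⟨rfl, rfl⟩
      exact ⟨hx, rfl⟩

/-- The successor permutation of a cycle digraph. -/
lemma IsCycleDigraph.exists_perm {α : Type} [DecidableEq α] {H : FinDigraph α}
    (h : IsCycleDigraph H) :
    ∃ σ : Equiv.Perm α, σ.IsCycle ∧ (∀ x, x ∈ H.V ↔ σ x ≠ x) ∧
      ∀ x y, (x, y) ∈ H.E ↔ σ x = y ∧ x ≠ y := by
  classical
  obtain ⟨hwf, hcard, hsc, hlin⟩ := h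
  choose s hs hs' using fun x (hx : x ∈ H.V) => FinDigraph.outDeg_eq_one_iff.1 (hlin x hx).2
  choose p hp hp' using fun x (hx : x ∈ H.V) => FinDigraph.inDeg_eq_one_iff.1 (hlin x hx).1
  have hsV : ∀ x hx, s x hx ∈ H.V := fun x hx => (hwf _ (hs x hx)).2.1
  have hpV : ∀ x hx, p x hx ∈ H.V := fun x hx => (hwf _ (hp x hx)).1
  let σ : Equiv.Perm α :=
    { toFun := fun x => if hx : x ∈ H.V then s x hx else x
      invFun := fun x => if hx : x ∈ H.V then p x hx else x
      left_inv := by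
        intro x
        by_cases hx : x ∈ H.V
        · simp only [hx, dif_pos, hsV]
          exact (hp' _ _ x (hs x hx)).symm
        · simp [hx]
      right_inv := by
        intro x
        by_cases hx : x ∈ H.V
        · simp only [hx, dif_pos, hpV]
          exact (hs' _ _ x (hp x hx)).symm
        · simp [hx] }
  have hσ : ∀ x (hx : x ∈ H.V), σ x = s x hx := fun x hx => dif_pos hx
  have hV : ∀ x, x ∈ H.V ↔ σ x ≠ x := by
    intro x
    constructor
    · intro hx
      rw [hσ x hx]
      exact (hwf _ (hs x hx)).2.2.symm
    · intro h
      by_contra hx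
      exact h (dif_neg hx)
  have hE : ∀ x y, (x, y) ∈ H.E ↔ σ x = y ∧ x ≠ y := by
    intro x y
    constructor
    · intro h
      have hx := (hwf _ h).1
      exact ⟨(hσ x hx).trans (hs' x hx y h).symm, (hwf _ h).2.2⟩
    · rintro ⟨rfl, hne⟩
      have hx := (hV x).2 hne.symm
      rw [hσ x hx]
      exact hs x hx
  refine ⟨σ, ?_, hV, hE⟩
  obtain ⟨a, ha⟩ := Finset.card_pos.1 (by omega : 0 < H.V.card)
  refine ⟨a, (hV a).1 ha, fun b hb => ?_⟩
  have hab := hsc a ha b ((hV b).2 hb)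
  clear hb
  induction hab with
  | refl => exact Equiv.Perm.SameCycle.refl _ _
  | tail _ h ih => exact ih.trans ⟨1, by simpa using ((hE _ _).1 h).1⟩

lemma isCycleDigraph_of_perm {α : Type} [DecidableEq α] {H : FinDigraph α} {σ : Equiv.Perm α}
    (hc : σ.IsCycle) (hV : ∀ x, x ∈ H.V ↔ σ x ≠ x)
    (hE : ∀ x y, (x, y) ∈ H.E ↔ σ x = y ∧ x ≠ y) : IsCycleDigraph H := by
  have hσV : ∀ x ∈ H.V, σ x ∈ H.V := fun x hx =>
    (hV _).2 fun h => (hV x).1 hx (σ.injective h)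
  have hσE : ∀ x ∈ H.V, (x, σ x) ∈ H.E := fun x hx => (hE _ _).2 ⟨rfl, ((hV x).1 hx).symm⟩
  refine ⟨?_, ?_, ?_, ?_⟩
  · rintro ⟨x, y⟩ h
    obtain ⟨rfl, hne⟩ := (hE _ _).1 h
    have := (hV x).2 hne.symm
    exact ⟨this, hσV x this, hne⟩
  · obtain ⟨x, hx, -⟩ := hc
    exact Finset.one_lt_card.2 ⟨x, (hV x).2 hx, σ x, hσV x ((hV x).2 hx), hx.symm⟩
  · intro a ha b hb
    let P : α → Prop := fun y => y ∈ H.V ∧ Relation.ReflTransGen (fun x y => (x, y) ∈ H.E) a y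
    have : Finite {y // P y} := (H.V.finite_toSet.subset fun y hy => hy.1).to_subtype
    have hP : ∀ y, P y → P (σ y) := fun y hy => ⟨hσV y hy.1, hy.2.tail (hσE y hy.1)⟩
    have hP' : ∀ y, P y → P (σ⁻¹ y) := by
      intro y hy
      have hinj : Function.Injective fun z : {y // P y} => (⟨σ z, hP z z.2⟩ : {y // P y}) :=
        fun z w h => Subtype.ext (σ.injective (congrArg Subtype.val h))
      obtain ⟨z, hz⟩ := Finite.surjective_of_injective hinj ⟨y, hy⟩
      obtain rfl : σ z = y := congrArg Subtype.val hz
      simpa using z.2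
    obtain ⟨n, rfl⟩ := hc.sameCycle ((hV a).1 ha) ((hV b).1 hb)
    suffices h : P ((σ ^ n) a) from h.2
    clear hb
    induction n with
    | zero => exact ⟨ha, Relation.ReflTransGen.refl⟩
    | succ n ih =>
      rw [add_comm, zpow_add, zpow_one, Equiv.Perm.mul_apply]
      exact hP _ ih
    | pred n ih =>
      rw [sub_eq_add_neg, add_comm, zpow_add, zpow_neg_one, Equiv.Perm.mul_apply]
      exact hP' _ ih
  · intro x hx
    rw [FinDigraph.inDeg_eq_one_iff, FinDigraph.outDeg_eq_one_iff]
    refine ⟨⟨σ⁻¹ x, (hE _ _).2 ⟨by simp, fun h => (hV x).1 hx ?_⟩, fun y hy => ?_⟩,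
      ⟨σ x, hσE x hx, fun y hy => ((hE _ _).1 hy).1.symm⟩⟩
    · conv_lhs => rw [← h]
      simp
    · rw [← ((hE _ _).1 hy).1]; simp

lemma ncard_cycleSubdigraphs {α : Type} [DecidableEq α] {G : FinDigraph α} (hG : G.WellFormed) :
    {H : FinDigraph α | Subdigraph H G ∧ IsCycleDigraph H}.ncard =
      (cyclePerms fun a b => (a, b) ∈ G.E).ncard := by
  symm
  have hV : ∀ σ ∈ cyclePerms fun a b => (a, b) ∈ G.E, ∀ x,
      x ∈ G.V.filter (fun x => σ x ≠ x) ↔ σ x ≠ x := fun σ hσ x => by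
    simpa using fun h => (hG _ (hσ.2 x h)).1
  have hE : ∀ σ ∈ cyclePerms fun a b => (a, b) ∈ G.E, ∀ x y,
      (x, y) ∈ G.E.filter (fun p => σ p.1 = p.2) ↔ σ x = y ∧ x ≠ y := by
    intro σ hσ x y
    rw [Finset.mem_filter]
    constructor
    · rintro ⟨h, h'⟩
      exact ⟨h', (hG _ h).2.2⟩
    · rintro ⟨rfl, h⟩
      exact ⟨hσ.2 x h.symm, rfl⟩
  refine Set.ncard_congr (fun σ _ => ⟨G.V.filter (fun x => σ x ≠ x),
    G.E.filter (fun p => σ p.1 = p.2)⟩) ?_ ?_ ?_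
  · intro σ hσ
    exact ⟨⟨Finset.filter_subset _ _, Finset.filter_subset _ _⟩,
      isCycleDigraph_of_perm hσ.1 (hV σ hσ) (hE σ hσ)⟩
  · intro σ τ hσ hτ h
    simp only [FinDigraph.mk.injEq] at h
    ext x
    by_cases hx : σ x = x
    · have := (hV σ hσ x).not.2 (by simpa using hx)
      rw [h.1, hV τ hτ x, not_not] at this
      rw [hx, this]
    · have := (hE σ hσ x (σ x)).2 ⟨rfl, Ne.symm hx⟩
      rw [h.2, hE τ hτ] at this
      exact this.1.symm
  · rintro H ⟨⟨hHV, hHE⟩, hH⟩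
    obtain ⟨σ, hc, hσV, hσE⟩ := hH.exists_perm
    have hσ : σ ∈ cyclePerms fun a b => (a, b) ∈ G.E :=
      ⟨hc, fun x hx => hHE ((hσE _ _).2 ⟨rfl, hx.symm⟩)⟩
    refine ⟨σ, hσ, ?_⟩
    obtain ⟨V, E⟩ := H
    simp only [FinDigraph.mk.injEq]
    constructor
    · ext x
      rw [hV σ hσ, ← hσV]
    · ext ⟨x, y⟩
      rw [hE σ hσ, ← hσE]

lemma SplitVertex.wellFormed {α : Type} [DecidableEq α] {G G' : FinDigraph α}
    (h : SplitVertex G G') (hG : G.WellFormed) : G'.WellFormed := by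
  obtain ⟨x, u, v, hx, hu, hv, huv, hV, hE⟩ := h
  rintro ⟨a, b⟩ hab
  have := fun a b => hG (a, b)
  simp only [hE, hV, Finset.mem_insert, Finset.mem_union, Finset.mem_filter, Finset.mem_image,
    Finset.mem_erase, Prod.mk.injEq, Prod.exists] at hab ⊢
  grind

lemma SplitArc.wellFormed {α : Type} [DecidableEq α] {G G' : FinDigraph α}
    (h : SplitArc G G') (hG : G.WellFormed) : G'.WellFormed := by
  obtain ⟨x, y, v, hxy, hv, hV, hE⟩ := h
  rintro ⟨a, b⟩ hab
  have := fun a b => hG (a, b)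
  simp only [hE, hV, Finset.mem_insert, Finset.mem_erase, Prod.mk.injEq] at hab ⊢
  grind

lemma SplitVertex.ncard_cyclePerms {α : Type} [DecidableEq α] {G G' : FinDigraph α}
    (h : SplitVertex G G') (hG : G.WellFormed) :
    (cyclePerms fun a b => (a, b) ∈ G'.E).ncard = (cyclePerms fun a b => (a, b) ∈ G.E).ncard := by
  obtain ⟨x, u, v, hx, hu, hv, huv, -, hE⟩ := h
  have hwf : ∀ a b, (a, b) ∈ G.E → a ∈ G.V ∧ b ∈ G.V ∧ a ≠ b := fun a b => hG (a, b)
  rw [← ncard_cyclePerms_map (fun a b => (a, b) ∈ G.E) (Equiv.swap x u).injective]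
  have hmap : ∀ a b, Relation.Map (fun a b => (a, b) ∈ G.E) (Equiv.swap x u) (Equiv.swap x u) a b ↔
      (Equiv.swap x u a, Equiv.swap x u b) ∈ G.E := by
    intro a b
    constructor
    · rintro ⟨c, d, h, rfl, rfl⟩
      simpa using h
    · intro h
      exact ⟨_, _, h, by simp, by simp⟩
  refine ncard_cyclePerms_split huv ?_ ?_ ?_ ?_ ?_ ?_ <;>
    simp only [hmap, hE, Finset.mem_insert, Finset.mem_union, Finset.mem_filter, Finset.mem_image,
      Prod.mk.injEq, Prod.exists, Equiv.swap_apply_def] <;> grind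

lemma SplitArc.ncard_cyclePerms {α : Type} [DecidableEq α] {G G' : FinDigraph α}
    (h : SplitArc G G') (hG : G.WellFormed) :
    (cyclePerms fun a b => (a, b) ∈ G'.E).ncard = (cyclePerms fun a b => (a, b) ∈ G.E).ncard := by
  obtain ⟨x, y, v, hxy, hv, -, hE⟩ := h
  have hwf : ∀ a b, (a, b) ∈ G.E → a ∈ G.V ∧ b ∈ G.V ∧ a ≠ b := fun a b => hG (a, b)
  refine ncard_cyclePerms_split (u := x) (v := v) (by grind) ?_ ?_ ?_ ?_ (by grind) (by grind) <;>
    simp only [hE, Finset.mem_insert, Finset.mem_erase, Prod.mk.injEq, ne_eq] <;> grind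

lemma IsDoubleCycle.exists_map_eq {α : Type} [DecidableEq α] {m : ℕ} {G : FinDigraph α}
    (h : IsDoubleCycle m G) :
    ∃ g : ZMod m → α, Function.Injective g ∧ (∀ i, g i ∈ G.V) ∧
      (fun a b => (a, b) ∈ G.E) = Relation.Map (fun i j => j = i + 1 ∨ i = j + 1) g g := by
  obtain ⟨hm, f, hf, hE⟩ := h
  have : NeZero m := ⟨by omega⟩
  have : Fact (1 < m) := ⟨by omega⟩
  have hmem : ∀ i : ZMod m, i.val ∈ (↑(stdDoubleCycle m).V : Set ℕ) := fun i => by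
    simpa [stdDoubleCycle] using ZMod.val_lt i
  have hsucc : ∀ i : ZMod m, (i.val + 1) % m = (i + 1).val := fun i => by
    rw [ZMod.val_add, ZMod.val_one]
  refine ⟨fun i => f i.val, fun i j hij => ZMod.val_injective m (hf.injOn (hmem i) (hmem j) hij),
    fun i => hf.mapsTo (hmem i), ?_⟩
  ext a b
  rw [← hE]
  simp only [stdDoubleCycle, Finset.mem_image, Finset.mem_biUnion, Finset.mem_range,
    Finset.mem_insert, Finset.mem_singleton, Prod.exists, Prod.mk.injEq, Relation.Map]
  constructor
  · rintro ⟨k, l, ⟨i, hi, h⟩, rfl, rfl⟩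
    have hval : (i : ZMod m).val = i := ZMod.val_cast_of_lt hi
    have hval' : ((i : ZMod m) + 1).val = (i + 1) % m := by rw [← hsucc, hval]
    rcases h with ⟨rfl, rfl⟩ | ⟨rfl, rfl⟩
    · exact ⟨k, k + 1, Or.inl rfl, by rw [hval], by rw [hval']⟩
    · exact ⟨l + 1, l, Or.inr rfl, by rw [hval'], by rw [hval]⟩
  · rintro ⟨i, j, rfl | rfl, rfl, rfl⟩
    · exact ⟨_, _, ⟨i.val, ZMod.val_lt i, Or.inl ⟨rfl, (hsucc i).symm⟩⟩, rfl, rfl⟩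
    · exact ⟨_, _, ⟨j.val, ZMod.val_lt j, Or.inr ⟨(hsucc j).symm, rfl⟩⟩, rfl, rfl⟩

lemma IsDoubleCycle.wellFormed {α : Type} [DecidableEq α] {m : ℕ} {G : FinDigraph α}
    (h : IsDoubleCycle m G) : G.WellFormed := by
  have : Fact (1 < m) := ⟨by have := h.1; omega⟩
  obtain ⟨g, hg, hV, hE⟩ := h.exists_map_eq
  rintro ⟨a, b⟩ hab
  obtain ⟨i, j, hij, rfl, rfl⟩ := (congrFun (congrFun hE a) b).mp hab
  refine ⟨hV i, hV j, hg.ne ?_⟩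
  rcases hij with rfl | rfl <;> simp

lemma IsDoubleCycle.ncard_cyclePerms {α : Type} [DecidableEq α] {m : ℕ} {G : FinDigraph α}
    (h : IsDoubleCycle m G) : (cyclePerms fun a b => (a, b) ∈ G.E).ncard = m + 2 := by
  obtain ⟨g, hg, -, hE⟩ := h.exists_map_eq
  rw [hE, ncard_cyclePerms_map _ hg, ncard_cyclePerms_zmod m h.1]

lemma IsWDC.wellFormed_and_ncard_cyclePerms {α : Type} [DecidableEq α] {m : ℕ} {G : FinDigraph α}
    (h : IsWDC m G) :
    G.WellFormed ∧ (cyclePerms fun a b => (a, b) ∈ G.E).ncard = m + 2 := by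
  obtain ⟨G₀, h₀, hG⟩ := h
  induction hG with
  | refl => exact ⟨h₀.wellFormed, h₀.ncard_cyclePerms⟩
  | tail _ h ih =>
    rcases h with h | h
    · exact ⟨h.wellFormed ih.1, (h.ncard_cyclePerms ih.1).trans ih.2⟩
    · exact ⟨h.wellFormed ih.1, (h.ncard_cyclePerms ih.1).trans ih.2⟩

theorem stmt15 (m : ℕ) (hm : 3 ≤ m) (G : FinDigraph ℕ) (hG : IsWDC m G) :
    {H : FinDigraph ℕ | Subdigraph H G ∧ IsCycleDigraph H}.ncard = m + 2 := by
  obtain ⟨hwf, hcard⟩ := hG.wellFormed_and_ncard_cyclePerms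
  rw [ncard_cycleSubdigraphs hwf, hcard]
end

section
/- Every minimally unsatisfiable 2-clause-set F of deficiency 1 with F ≠ {⊥} (F is not the clause-set consisting of the empty clause alone) is isomorphic to exactly one clause-set from the following four families, with n = n(F): (1) U²_n for n ≥ 1; (2) U¹_{n,i} for n ≥ 2 and 1 ≤ i ≤ n−1; (3) U⁰_{n,i} for n ≥ 3 and 2 ≤ i ≤ (n+1)/2; (4) U⁰_{n,x,y} for n ≥ 4, 2 ≤ x < y ≤ n−1 and x + y ≤ n+1. Furthermore F falls into family (1) iff F has exactly two unit-clauses, into family (2) iff F has exactly one unit-clause, and into family (3) or (4) iff F has no unit-clause, where (3) applies iff F has a variable of variable-degree 4. -/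
/-- Literals over the same variable are equal or complementary. -/
lemma Lit.eq_or_eq_compl {a b : Lit} (h : a.1 = b.1) : a = b ∨ a = b.compl := by
  obtain ⟨a1, a2⟩ := a
  obtain ⟨b1, b2⟩ := b
  cases a2 <;> cases b2 <;> simp_all [Lit.compl]

@[simp] lemma Lit.compl_compl (a : Lit) : a.compl.compl = a := by simp [Lit.compl]

@[simp] lemma Lit.compl_fst (a : Lit) : a.compl.1 = a.1 := rfl

@[simp] lemma Lit.compl_mk (i : ℕ) (b : Bool) : Lit.compl (i, b) = (i, !b) := rfl

lemma Lit.compl_ne (a : Lit) : a.compl ≠ a := by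
  intro h
  have := congrArg Prod.snd h
  simp [Lit.compl] at this

lemma Lit.compl_inj {a b : Lit} : a.compl = b.compl ↔ a = b :=
  ⟨fun h => by simpa using congrArg Lit.compl h, fun h => h ▸ rfl⟩

lemma LitVal_compl (φ : ℕ → Bool) (x : Lit) : LitVal φ x.compl = !LitVal φ x := by
  obtain ⟨v, b⟩ := x
  cases b <;> simp [LitVal, Lit.compl]

lemma LitVal_update_of_ne {φ : ℕ → Bool} {v : ℕ} {b : Bool} {x : Lit} (h : x.1 ≠ v) :
    LitVal (Function.update φ v b) x = LitVal φ x := by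
  simp [LitVal, h]

lemma LitVal_update_self (φ : ℕ → Bool) (x : Lit) :
    LitVal (Function.update φ x.1 x.2) x = true := by
  obtain ⟨v, b⟩ := x
  cases b <;> simp [LitVal]

lemma pair_eq_pair_iff' {α : Type*} [DecidableEq α] {a b c d : α} :
    ({a, b} : Finset α) = {c, d} ↔ (a = c ∧ b = d) ∨ (a = d ∧ b = c) := by
  rw [← Finset.coe_inj]
  push_cast
  exact Set.pair_eq_pair_iff

lemma mem_varsOf {F : Finset (Finset Lit)} {v : ℕ} :
    v ∈ varsOf F ↔ ∃ C ∈ F, ∃ x ∈ C, x.1 = v := by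
  simp only [varsOf, Finset.mem_biUnion, Finset.mem_image]

lemma mem_litsOf {F : Finset (Finset Lit)} {x : Lit} : x ∈ litsOf F ↔ x.1 ∈ varsOf F := by
  simp [litsOf]

lemma mem_litsOf_of_mem {F : Finset (Finset Lit)} {C : Finset Lit} {x : Lit}
    (hC : C ∈ F) (hx : x ∈ C) : x ∈ litsOf F :=
  mem_litsOf.2 (mem_varsOf.2 ⟨C, hC, x, hx, rfl⟩)

lemma card_litsOf (F : Finset (Finset Lit)) : (litsOf F).card = 2 * (varsOf F).card := by
  simp [litsOf, mul_comm]

namespace CNFIso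

variable {F G H : Finset (Finset Lit)} {f g : Lit → Lit}

lemma symm (h : CNFIso F G f) : ∃ g, CNFIso G F g ∧ ∀ a ∈ litsOf F, g (f a) = a := by
  obtain ⟨hb, hc, rfl⟩ := h
  have hi := hb.invOn_invFunOn
  have hl : ∀ a ∈ litsOf F, Function.invFunOn f (litsOf F) (f a) = a := fun a ha => hi.1 ha
  refine ⟨Function.invFunOn f (litsOf F), ⟨hb.symm hi.symm, ?_, ?_⟩, hl⟩
  · intro y hy
    obtain ⟨x, hx, rfl⟩ := hb.surjOn hy
    rw [← hc x hx, hl _ hx, hl _ (compl_mem hx)]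
  · rw [Finset.image_image]
    refine (Finset.image_congr fun C hC => ?_).trans Finset.image_id
    simp only [Function.comp, Finset.image_image]
    refine (Finset.image_congr fun x hx => ?_).trans Finset.image_id
    exact hl x (mem_litsOf_of_mem hC hx)

lemma trans (h : CNFIso F G f) (h' : CNFIso G H g) : CNFIso F H (g ∘ f) := by
  obtain ⟨hb, hc, rfl⟩ := h
  obtain ⟨hb', hc', rfl⟩ := h'
  refine ⟨hb'.comp hb, ?_, ?_⟩
  · intro x hx
    simp only [Function.comp]
    rw [hc x hx, hc' _ (hb.mapsTo hx)]
  · simp only [Finset.image_image]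
    refine Finset.image_congr fun C _ => ?_
    simp [Function.comp, Finset.image_image]

lemma injOn_clauses (h : CNFIso F G f) :
    Set.InjOn (fun C : Finset Lit => C.image f) (F : Set (Finset Lit)) := by
  obtain ⟨g, -, hg⟩ := h.symm
  refine Set.LeftInvOn.injOn (f₁' := fun C => C.image g) fun C hC => ?_
  simp only [Finset.image_image]
  refine (Finset.image_congr fun x hx => ?_).trans Finset.image_id
  exact hg x (mem_litsOf_of_mem hC hx)

lemma mem_image (h : CNFIso F G f) {C : Finset Lit} (hC : C ∈ F) : C.image f ∈ G :=
  h.2.2 ▸ Finset.mem_image_of_mem _ hC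

lemma mem_litsOf (h : CNFIso F G f) {a : Lit} (ha : a ∈ litsOf F) : f a ∈ litsOf G :=
  h.1.mapsTo ha

lemma card_varsOf_eq (h : CNFIso F G f) : (varsOf F).card = (varsOf G).card := by
  have := Finset.card_nbij f h.1.mapsTo h.1.injOn h.1.surjOn
  rw [card_litsOf, card_litsOf] at this
  omega

lemma unitCount_eq (h : CNFIso F G f) : unitCount F = unitCount G := by
  have hcard : ∀ C ∈ F, (C.image f).card = C.card := fun C hC =>
    Finset.card_image_of_injOn fun a ha b hb hab =>
      h.1.injOn (mem_litsOf_of_mem hC ha) (mem_litsOf_of_mem hC hb) hab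
  refine Finset.card_nbij (fun C => C.image f) ?_ ?_ ?_
  · intro C hC
    rw [Finset.mem_coe, Finset.mem_filter] at hC ⊢
    exact ⟨h.mem_image hC.1, (hcard C hC.1).trans hC.2⟩
  · exact h.injOn_clauses.mono (Finset.coe_subset.2 (Finset.filter_subset _ _))
  · intro D hD
    rw [Finset.mem_coe, Finset.mem_filter] at hD
    obtain ⟨hD, hD1⟩ := hD
    rw [← h.2.2] at hD
    obtain ⟨C, hC, rfl⟩ := Finset.mem_image.1 hD
    exact ⟨C, by simpa using ⟨hC, (hcard C hC) ▸ hD1⟩, rfl⟩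

lemma ldeg_eq (h : CNFIso F G f) {a : Lit} (ha : a ∈ litsOf F) : ldeg F a = ldeg G (f a) := by
  refine Finset.card_nbij (fun C => C.image f) ?_ ?_ ?_
  · intro C hC
    rw [Finset.mem_coe, Finset.mem_filter] at hC ⊢
    exact ⟨h.mem_image hC.1, Finset.mem_image_of_mem _ hC.2⟩
  · exact h.injOn_clauses.mono (Finset.coe_subset.2 (Finset.filter_subset _ _))
  · intro D hD
    rw [Finset.mem_coe, Finset.mem_filter] at hD
    obtain ⟨hD, hD1⟩ := hD
    rw [← h.2.2] at hD
    obtain ⟨C, hC, rfl⟩ := Finset.mem_image.1 hD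
    obtain ⟨x, hx, hxa⟩ := Finset.mem_image.1 hD1
    rw [h.1.injOn (mem_litsOf_of_mem hC hx) ha hxa] at hx
    exact ⟨C, by simpa using ⟨hC, hx⟩, rfl⟩

lemma exists_vdeg_eq (h : CNFIso F G f) {v : ℕ} (hv : v ∈ varsOf F) :
    ∃ w ∈ varsOf G, vdeg G w = vdeg F v := by
  have hl : ∀ b, (v, b) ∈ litsOf F := fun b => _root_.mem_litsOf.2 hv
  have hc : f (v, false) = (f (v, true)).compl := h.2.1 _ (hl true)
  refine ⟨(f (v, true)).1, _root_.mem_litsOf.1 (h.mem_litsOf (hl true)), ?_⟩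
  rw [vdeg, vdeg, h.ldeg_eq (hl true), h.ldeg_eq (hl false), hc]
  obtain ⟨w, b⟩ := f (v, true)
  cases b <;> simp [add_comm]

lemma exists_vdeg_iff (h : CNFIso F G f) (k : ℕ) :
    (∃ v ∈ varsOf F, vdeg F v = k) ↔ ∃ v ∈ varsOf G, vdeg G v = k := by
  obtain ⟨g, hg, -⟩ := h.symm
  constructor
  · rintro ⟨v, hv, rfl⟩
    exact h.exists_vdeg_eq hv
  · rintro ⟨v, hv, rfl⟩
    exact hg.exists_vdeg_eq hv

end CNFIso

lemma mem_famU0 {n x y : ℕ} {C : Finset Lit} :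
    C ∈ famU0 n x y ↔ (∃ i, 1 ≤ i ∧ i < n ∧ C = {(i, false), (i + 1, true)}) ∨
      C = {(1, true), (x, true)} ∨ C = {(n, false), (y, false)} := by
  simp only [famU0, Mn, Finset.mem_union, Finset.mem_image, Finset.mem_Icc, Finset.mem_insert,
    Finset.mem_singleton]
  refine or_congr ⟨?_, ?_⟩ Iff.rfl
  · rintro ⟨i, hi, rfl⟩
    exact ⟨i, hi.1, by omega, rfl⟩
  · rintro ⟨i, hi, hn, rfl⟩
    exact ⟨i, ⟨hi, by omega⟩, rfl⟩

/-- The explicit form of the clauses `{a, b}` of `famU0 n x y`. -/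
lemma pair_mem_famU0 {n x y : ℕ} {a b : Lit} :
    ({a, b} : Finset Lit) ∈ famU0 n x y ↔
      (∃ i, 1 ≤ i ∧ i < n ∧
        (a = (i, false) ∧ b = (i + 1, true) ∨ a = (i + 1, true) ∧ b = (i, false))) ∨
      (a = (1, true) ∧ b = (x, true) ∨ a = (x, true) ∧ b = (1, true)) ∨
      (a = (n, false) ∧ b = (y, false) ∨ a = (y, false) ∧ b = (n, false)) := by
  simp only [mem_famU0, pair_eq_pair_iff']

lemma famU2_eq (n : ℕ) : famU2 n = famU0 n 1 n := by simp [famU2, famU0]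

lemma famU1_eq (n i : ℕ) : famU1 n i = famU0 n 1 i := by simp [famU1, famU0]

lemma famU0s_eq (n i : ℕ) : famU0s n i = famU0 n i i := rfl

/-- All four families together are the sets `famU0 n x y` with `1 ≤ x ≤ y ≤ n`, `x + y ≤ n + 1`. -/
lemma inFam_iff {G : Finset (Finset Lit)} :
    InFam G ↔ ∃ n x y, 1 ≤ x ∧ x ≤ y ∧ y ≤ n ∧ x + y ≤ n + 1 ∧ G = famU0 n x y := by
  simp only [InFam, famU2_eq, famU1_eq, famU0s_eq]
  constructor
  · rintro (⟨n, h, rfl⟩ | ⟨n, i, h1, h2, h3, rfl⟩ | ⟨n, i, h1, h2, h3, rfl⟩ |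
      ⟨n, x, y, h1, h2, h3, h4, h5, rfl⟩)
    · exact ⟨n, 1, n, by omega, by omega, by omega, by omega, rfl⟩
    · exact ⟨n, 1, i, by omega, by omega, by omega, by omega, rfl⟩
    · exact ⟨n, i, i, by omega, by omega, by omega, by omega, rfl⟩
    · exact ⟨n, x, y, by omega, by omega, by omega, by omega, rfl⟩
  · rintro ⟨n, x, y, h1, h2, h3, h4, rfl⟩
    rcases h1.eq_or_lt with rfl | h1
    · rcases h3.eq_or_lt with rfl | h3
      · exact Or.inl ⟨y, by omega, rfl⟩
      · exact Or.inr (Or.inl ⟨n, y, by omega, by omega, by omega, rfl⟩)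
    · rcases h2.eq_or_lt with rfl | h2
      · exact Or.inr (Or.inr (Or.inl ⟨n, x, by omega, by omega, by omega, rfl⟩))
      · exact Or.inr (Or.inr (Or.inr
          ⟨n, x, y, by omega, by omega, by omega, by omega, by omega, rfl⟩))

lemma varsOf_famU0 {n x y : ℕ} (hx : 1 ≤ x) (hxy : x ≤ y) (hy : y ≤ n) :
    varsOf (famU0 n x y) = Finset.Icc 1 n := by
  ext v
  rw [mem_varsOf, Finset.mem_Icc]
  constructor
  · rintro ⟨C, hC, l, hl, rfl⟩
    rcases mem_famU0.1 hC with ⟨i, h1, h2, rfl⟩ | rfl | rfl <;>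
      (simp only [Finset.mem_insert, Finset.mem_singleton] at hl
       rcases hl with rfl | rfl <;> (dsimp only; omega))
  · rintro ⟨h1, h2⟩
    rcases h2.eq_or_lt with rfl | h2
    · exact ⟨_, mem_famU0.2 (Or.inr (Or.inr rfl)), (v, false), by simp, rfl⟩
    · exact ⟨_, mem_famU0.2 (Or.inl ⟨v, h1, h2, rfl⟩), (v, false), by simp, rfl⟩

/-- Walks of length `k` in the implication digraph. -/
def ImplWalk (F : Finset (Finset Lit)) : ℕ → Lit → Lit → Prop
  | 0, a, b => a = b
  | k + 1, a, b => ∃ c, ImplWalk F k a c ∧ {c.compl, b} ∈ F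

lemma CNFIso.implWalk {F G : Finset (Finset Lit)} {f : Lit → Lit} (h : CNFIso F G f) {a : Lit} :
    ∀ {k b}, ImplWalk F k a b → ImplWalk G k (f a) (f b)
  | 0, _, hw => congrArg f hw
  | k + 1, b, ⟨c, hw, hc⟩ => by
    refine ⟨f c, h.implWalk hw, ?_⟩
    have hl : c ∈ litsOf F := by simpa using compl_mem (mem_litsOf_of_mem hc (by simp : c.compl ∈ _))
    simpa [Finset.image_insert, h.2.1 c hl] using h.mem_image hc

lemma implWalk_famU0 {n x y : ℕ} (hx : 1 ≤ x) (hxy : x ≤ y) (hy : y ≤ n) :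
    ImplWalk (famU0 n x y) x (x, false) (x, true) := by
  have key : ∀ k, k + 1 ≤ x → ImplWalk (famU0 n x y) (k + 1) (x, false) (k + 1, true) := by
    intro k
    induction k with
    | zero => exact fun _ => ⟨(x, false), rfl, by simp [pair_mem_famU0]⟩
    | succ k ih =>
      exact fun hk => ⟨_, ih (by omega), pair_mem_famU0.2 (Or.inl ⟨k + 1, by omega, by omega, by simp⟩)⟩
  obtain ⟨k, rfl⟩ : ∃ k, x = k + 1 := ⟨x - 1, by omega⟩
  exact key k le_rfl

/-- A walk from `(x, false)` to `(x, true)` in `famU0 n x y` has length at least `x`. -/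
lemma le_of_implWalk_famU0 {n x y k : ℕ} (hx : 1 ≤ x) (hxy : x ≤ y) (hy : y ≤ n)
    (h : ImplWalk (famU0 n x y) k (x, false) (x, true)) : x ≤ k := by
  let dist : Lit → ℕ := fun a => if a.2 then min a.1 x else if a.1 ≤ x then x - a.1 else x
  have key : ∀ k b, ImplWalk (famU0 n x y) k (x, false) b → dist b ≤ k := by
    intro k
    induction k with
    | zero =>
      rintro b rfl
      simp [dist]
    | succ k ih =>
      rintro b ⟨⟨i, s⟩, hw, hc⟩
      have hk := ih _ hw
      rw [pair_mem_famU0] at hc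
      simp only [Lit.compl_mk, Prod.mk.injEq, dist] at hc hk ⊢
      cases s <;> simp only [Bool.not_true, Bool.not_false, and_true, and_false, false_and, or_false,
        false_or, reduceCtorEq, Bool.false_eq_true, if_true, if_false] at hc hk
      · rcases hc with ⟨j, h1, h2, rfl, rfl⟩ | ⟨rfl, rfl⟩ | ⟨rfl, rfl⟩ <;> simp only [] <;>
          split_ifs at * <;> simp_all <;> omega
      · rcases hc with ⟨j, h1, h2, rfl, rfl⟩ | ⟨rfl, rfl⟩ | ⟨rfl, rfl⟩ <;> simp only [] <;>
          split_ifs at * <;> simp_all <;> omega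
  simpa [dist] using key k _ h

/-- A literal with a unit-clause or with at least two clauses. -/
def BranchLit (F : Finset (Finset Lit)) (a : Lit) : Prop :=
  {a} ∈ F ∨ ∃ b c, b ≠ c ∧ {a, b} ∈ F ∧ {a, c} ∈ F

lemma CNFIso.branchLit {F G : Finset (Finset Lit)} {f : Lit → Lit} (h : CNFIso F G f) {a : Lit}
    (ha : BranchLit F a) : BranchLit G (f a) := by
  rcases ha with ha | ⟨b, c, hbc, hb, hc⟩
  · exact Or.inl (by simpa using h.mem_image ha)
  · refine Or.inr ⟨f b, f c, fun he => hbc ?_, ?_, ?_⟩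
    · exact h.1.injOn (mem_litsOf_of_mem hb (by simp)) (mem_litsOf_of_mem hc (by simp)) he
    · simpa [Finset.image_insert] using h.mem_image hb
    · simpa [Finset.image_insert] using h.mem_image hc

lemma branchLit_famU0 {n x y : ℕ} (hx : 1 ≤ x) (hxy : x ≤ y) (hy : y ≤ n) {a : Lit} :
    BranchLit (famU0 n x y) a ↔ a = (x, true) ∨ a = (y, false) := by
  constructor
  · rintro (h | ⟨b, c, hbc, hb, hc⟩)
    · rw [← Finset.pair_eq_singleton, pair_mem_famU0] at h
      rcases h with ⟨i, h1, h2, h⟩ | h | h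
      · rcases h with ⟨rfl, h⟩ | ⟨rfl, h⟩ <;> simp at h
      · tauto
      · tauto
    · obtain ⟨v, s⟩ := a
      rw [pair_mem_famU0] at hb hc
      simp only [Prod.mk.injEq] at hb hc ⊢
      cases s <;> simp only [and_true, and_false, false_and, or_false, false_or, reduceCtorEq]
        at hb hc ⊢
      · rcases hb with ⟨i, h1, h2, rfl, rfl⟩ | ⟨rfl, rfl⟩ | ⟨rfl, rfl⟩ <;>
          rcases hc with ⟨j, h3, h4, h5, rfl⟩ | ⟨h5, rfl⟩ | ⟨h5, rfl⟩ <;>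
          simp only [ne_eq, Prod.mk.injEq, and_true, not_true, reduceCtorEq, and_false,
            not_false_eq_true] at hbc <;> omega
      · rcases hb with ⟨i, h1, h2, rfl, rfl⟩ | ⟨rfl, rfl⟩ | ⟨rfl, rfl⟩ <;>
          rcases hc with ⟨j, h3, h4, h5, rfl⟩ | ⟨h5, rfl⟩ | ⟨h5, rfl⟩ <;>
          simp only [ne_eq, Prod.mk.injEq, and_true, not_true, reduceCtorEq, and_false,
            not_false_eq_true] at hbc <;> omega
  · rintro (rfl | rfl)
    · rcases hx.eq_or_lt with rfl | h
      · exact Or.inl (by rw [← Finset.pair_eq_singleton, pair_mem_famU0]; simp)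
      · refine Or.inr ⟨(1, true), (x - 1, false), by simp, by simp [pair_mem_famU0],
          pair_mem_famU0.2 (Or.inl ⟨x - 1, by omega, by omega, ?_⟩)⟩
        simp; omega
    · rcases hy.eq_or_lt with rfl | h
      · exact Or.inl (by rw [← Finset.pair_eq_singleton, pair_mem_famU0]; simp)
      · exact Or.inr ⟨(n, false), (y + 1, true), by simp, by simp [pair_mem_famU0],
          pair_mem_famU0.2 (Or.inl ⟨y, by omega, by omega, by simp⟩)⟩

/-- A presentation of `F` as a relabelling of `famU0 n x y`, where the literal `(i, true)` is
replaced by `l i`. -/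
structure Presents (F : Finset (Finset Lit)) (n x y : ℕ) (l : ℕ → Lit) : Prop where
  one_le : 1 ≤ x
  le : x ≤ y
  le_n : y ≤ n
  inj : ∀ i j, 1 ≤ i → i ≤ n → 1 ≤ j → j ≤ n → (l i).1 = (l j).1 → i = j
  mem_iff : ∀ C, C ∈ F ↔ (∃ i, 1 ≤ i ∧ i < n ∧ C = {(l i).compl, l (i + 1)}) ∨
      C = {l 1, l x} ∨ C = {(l n).compl, (l y).compl}

/-- The map of literals with `(i, true) ↦ l i` that commutes with complementation. -/
def litMap (l : ℕ → Lit) (a : Lit) : Lit := if a.2 then l a.1 else (l a.1).compl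

lemma litMap_compl (l : ℕ → Lit) (a : Lit) : litMap l a.compl = (litMap l a).compl := by
  obtain ⟨i, b⟩ := a
  cases b <;> simp [litMap]

lemma presents_famU0 {n x y : ℕ} (hx : 1 ≤ x) (hxy : x ≤ y) (hy : y ≤ n) :
    Presents (famU0 n x y) n x y (fun i => (i, true)) where
  one_le := hx
  le := hxy
  le_n := hy
  inj _ _ _ _ _ _ h := h
  mem_iff _ := mem_famU0

namespace Presents

variable {F : Finset (Finset Lit)} {n x y : ℕ} {l : ℕ → Lit}

/-- Reversing the order of the variables and complementing all of them. -/
lemma reverse (h : Presents F n x y l) :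
    Presents F n (n + 1 - y) (n + 1 - x) (fun i => (l (n + 1 - i)).compl) := by
  obtain ⟨hx, hxy, hy, inj, hF⟩ := h
  refine ⟨by omega, by omega, by omega, ?_, ?_⟩
  · intro i j h1 h2 h3 h4 h
    have := inj (n + 1 - i) (n + 1 - j) (by omega) (by omega) (by omega) (by omega) h
    omega
  · intro C
    have e1 : n + 1 - 1 = n := by omega
    have e2 : n + 1 - n = 1 := by omega
    have e3 : n + 1 - (n + 1 - y) = y := by omega
    have e4 : n + 1 - (n + 1 - x) = x := by omega
    simp only [hF, e1, e2, e3, e4, Lit.compl_compl]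
    refine or_congr ⟨?_, ?_⟩ or_comm
    · rintro ⟨i, h1, h2, rfl⟩
      refine ⟨n - i, by omega, by omega, ?_⟩
      rw [Finset.pair_comm, show n + 1 - (n - i) = i + 1 by omega,
        show n + 1 - (n - i + 1) = i by omega]
    · rintro ⟨i, h1, h2, rfl⟩
      refine ⟨n - i, by omega, by omega, ?_⟩
      rw [Finset.pair_comm, show n - i + 1 = n + 1 - i by omega,
        show n + 1 - (i + 1) = n - i by omega]

lemma mem_varsOf_iff (h : Presents F n x y l) {v : ℕ} :
    v ∈ varsOf F ↔ ∃ i, 1 ≤ i ∧ i ≤ n ∧ (l i).1 = v := by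
  obtain ⟨hx, hxy, hy, inj, hF⟩ := h
  rw [mem_varsOf]
  constructor
  · rintro ⟨C, hC, a, ha, rfl⟩
    rcases (hF C).1 hC with ⟨i, h1, h2, rfl⟩ | rfl | rfl <;>
      (simp only [Finset.mem_insert, Finset.mem_singleton] at ha
       rcases ha with rfl | rfl)
    · exact ⟨i, by omega, by omega, rfl⟩
    · exact ⟨i + 1, by omega, by omega, rfl⟩
    · exact ⟨1, by omega, by omega, rfl⟩
    · exact ⟨x, by omega, by omega, rfl⟩
    · exact ⟨n, by omega, by omega, rfl⟩
    · exact ⟨y, by omega, by omega, rfl⟩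
  · rintro ⟨i, h1, h2, rfl⟩
    rcases h2.eq_or_lt with rfl | h2
    · exact ⟨_, (hF _).2 (Or.inr (Or.inr rfl)), (l i).compl, by simp, rfl⟩
    · exact ⟨_, (hF _).2 (Or.inl ⟨i, h1, h2, rfl⟩), (l i).compl, by simp, rfl⟩

lemma cnfIso (h : Presents F n x y l) : CNFIso (famU0 n x y) F (litMap l) := by
  have hv := @mem_varsOf_iff _ _ _ _ _ h
  obtain ⟨hx, hxy, hy, inj, hF⟩ := h
  have hmem : ∀ a : Lit, a ∈ litsOf (famU0 n x y) ↔ 1 ≤ a.1 ∧ a.1 ≤ n := fun a => by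
    rw [mem_litsOf, varsOf_famU0 hx hxy hy, Finset.mem_Icc]
  have hfst : ∀ a, (litMap l a).1 = (l a.1).1 := fun a => by
    unfold litMap
    split_ifs <;> rfl
  refine ⟨⟨?_, ?_, ?_⟩, fun a _ => litMap_compl l a, ?_⟩
  · intro a ha
    have ha := (hmem a).1 ha
    exact mem_litsOf.2 (hv.2 ⟨a.1, ha.1, ha.2, (hfst a).symm⟩)
  · intro a ha b hb hab
    have ha := (hmem a).1 ha
    have hb := (hmem b).1 hb
    have he := congrArg Prod.fst hab
    rw [hfst, hfst] at he
    rcases Lit.eq_or_eq_compl (inj _ _ ha.1 ha.2 hb.1 hb.2 he) with he | he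
    · exact he
    · rw [he, litMap_compl] at hab
      exact absurd hab (Lit.compl_ne _)
  · intro b hb
    obtain ⟨i, h1, h2, h3⟩ := hv.1 (mem_litsOf.1 hb)
    rcases Lit.eq_or_eq_compl h3.symm with rfl | rfl
    · exact ⟨(i, true), (hmem _).2 ⟨h1, h2⟩, by simp [litMap]⟩
    · exact ⟨(i, false), (hmem _).2 ⟨h1, h2⟩, by simp [litMap]⟩
  · ext C
    rw [Finset.mem_image, hF]
    constructor
    · rintro ⟨D, hD, rfl⟩
      rcases mem_famU0.1 hD with ⟨i, h1, h2, rfl⟩ | rfl | rfl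
      · exact Or.inl ⟨i, h1, h2, by simp [litMap, Finset.image_insert]⟩
      · exact Or.inr (Or.inl (by simp [litMap, Finset.image_insert]))
      · exact Or.inr (Or.inr (by simp [litMap, Finset.image_insert]))
    · rintro (⟨i, h1, h2, rfl⟩ | rfl | rfl)
      · exact ⟨_, mem_famU0.2 (Or.inl ⟨i, h1, h2, rfl⟩), by simp [litMap, Finset.image_insert]⟩
      · exact ⟨_, mem_famU0.2 (Or.inr (Or.inl rfl)), by simp [litMap, Finset.image_insert]⟩
      · exact ⟨_, mem_famU0.2 (Or.inr (Or.inr rfl)), by simp [litMap, Finset.image_insert]⟩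

end Presents

/-- The isomorphism between `famU0 n x y` and its reversal. -/
def revLit (n : ℕ) : Lit → Lit := litMap fun i => (n + 1 - i, false)

lemma cnfIso_reverse {n x y : ℕ} (hx : 1 ≤ x) (hxy : x ≤ y) (hy : y ≤ n) :
    CNFIso (famU0 n x y) (famU0 n (n + 1 - y) (n + 1 - x)) (revLit n) := by
  have h := (presents_famU0 (n := n) (x := n + 1 - y) (y := n + 1 - x)
    (by omega) (by omega) (by omega)).reverse.cnfIso
  rwa [show n + 1 - (n + 1 - x) = x by omega, show n + 1 - (n + 1 - y) = y by omega] at h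

section Uniqueness

variable {n x y x' y' : ℕ} {f : Lit → Lit}

lemma eq_of_cnfIso_famU0_of_apply (hx : 1 ≤ x) (hxy : x ≤ y) (hy : y ≤ n) (hx' : 1 ≤ x')
    (hxy' : x' ≤ y') (hy' : y' ≤ n) (h : CNFIso (famU0 n x y) (famU0 n x' y') f)
    (hf : f (x, true) = (x', true)) : x = x' := by
  have key : ∀ {x y x' y' : ℕ} {f : Lit → Lit}, 1 ≤ x → x ≤ y → y ≤ n → 1 ≤ x' → x' ≤ y' →
      y' ≤ n → CNFIso (famU0 n x y) (famU0 n x' y') f → f (x, true) = (x', true) → x' ≤ x := by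
    intro x y x' y' f hx hxy hy hx' hxy' hy' h hf
    have hl : (x, true) ∈ litsOf (famU0 n x y) := by
      rw [mem_litsOf, varsOf_famU0 hx hxy hy, Finset.mem_Icc]; omega
    have hw := h.implWalk (implWalk_famU0 hx hxy hy)
    have hc := h.2.1 _ hl
    rw [hf, Lit.compl_mk, Lit.compl_mk, Bool.not_true] at hc
    rw [hf, hc] at hw
    exact le_of_implWalk_famU0 hx' hxy' hy' hw
  obtain ⟨g, hg, hgf⟩ := h.symm
  refine le_antisymm (key hx' hxy' hy' hx hxy hy hg ?_) (key hx hxy hy hx' hxy' hy' h hf)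
  rw [← hf, hgf]
  rw [mem_litsOf, varsOf_famU0 hx hxy hy, Finset.mem_Icc]; omega

lemma eq_and_eq_of_cnfIso_famU0_of_apply (hx : 1 ≤ x) (hxy : x ≤ y) (hy : y ≤ n) (hx' : 1 ≤ x')
    (hxy' : x' ≤ y') (hy' : y' ≤ n) (h : CNFIso (famU0 n x y) (famU0 n x' y') f)
    (hf : f (x, true) = (x', true)) : x = x' ∧ y = y' := by
  refine ⟨eq_of_cnfIso_famU0_of_apply hx hxy hy hx' hxy' hy' h hf, ?_⟩
  have hl : ∀ i b, 1 ≤ i → i ≤ n → ((i, b) : Lit) ∈ litsOf (famU0 n x y) := fun i b h1 h2 => by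
    rw [mem_litsOf, varsOf_famU0 hx hxy hy, Finset.mem_Icc]; exact ⟨h1, h2⟩
  have hfy : f (y, false) = (y', false) := by
    rcases (branchLit_famU0 hx' hxy' hy').1
      (h.branchLit ((branchLit_famU0 hx hxy hy).2 (Or.inr rfl))) with he | he
    · have := h.1.injOn (hl y false (by omega) hy) (hl x true hx (by omega)) (he.trans hf.symm)
      simp at this
    · exact he
  have h1 := cnfIso_reverse (n := n) (x := n + 1 - y) (y := n + 1 - x)
    (by omega) (by omega) (by omega)
  rw [show n + 1 - (n + 1 - x) = x by omega, show n + 1 - (n + 1 - y) = y by omega] at h1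
  have := eq_of_cnfIso_famU0_of_apply (by omega) (by omega) (by omega) (by omega) (by omega)
    (by omega) ((h1.trans h).trans (cnfIso_reverse hx' hxy' hy')) (by
      have e : revLit n (n + 1 - y, true) = (y, false) := by simp [revLit, litMap]; omega
      simp only [Function.comp, e, hfy]
      simp [revLit, litMap])
  omega

lemma eq_and_eq_of_cnfIso_famU0 (hx : 1 ≤ x) (hxy : x ≤ y) (hy : y ≤ n) (hs : x + y ≤ n + 1)
    (hx' : 1 ≤ x') (hxy' : x' ≤ y') (hy' : y' ≤ n) (hs' : x' + y' ≤ n + 1)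
    (h : CNFIso (famU0 n x y) (famU0 n x' y') f) : x = x' ∧ y = y' := by
  rcases (branchLit_famU0 hx' hxy' hy').1
    (h.branchLit ((branchLit_famU0 hx hxy hy).2 (Or.inl rfl))) with he | he
  · exact eq_and_eq_of_cnfIso_famU0_of_apply hx hxy hy hx' hxy' hy' h he
  · have := eq_and_eq_of_cnfIso_famU0_of_apply hx hxy hy (by omega) (by omega) (by omega)
      (h.trans (cnfIso_reverse hx' hxy' hy')) (by simp [he, revLit, litMap])
    omega

end Uniqueness

section Counting

variable {n x y : ℕ}

lemma unitCount_famU0 :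
    unitCount (famU0 n x y) = (if x = 1 then 1 else 0) + (if y = n then 1 else 0) := by
  have h : (famU0 n x y).filter (fun C => C.card = 1) =
      (if x = 1 then {{(1, true)}} else ∅) ∪ (if y = n then {{(n, false)}} else ∅) := by
    ext C
    rw [Finset.mem_filter, mem_famU0]
    constructor
    · rintro ⟨⟨i, h1, h2, rfl⟩ | rfl | rfl, hc⟩
      · rw [Finset.card_pair (by simp)] at hc
        omega
      · by_cases hx1 : x = 1
        · simp [hx1]
        · rw [Finset.card_pair (by simpa using Ne.symm hx1)] at hc
          omega
      · by_cases hyn : y = n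
        · simp [hyn]
        · rw [Finset.card_pair (by simpa using Ne.symm hyn)] at hc
          omega
    · intro hC
      split_ifs at hC <;> simp at hC
      · rcases hC with rfl | rfl <;> simp_all
      · subst hC; simp_all
      · subst hC; simp_all
  rw [unitCount, h]
  split_ifs <;> simp

lemma mem_famU0_of_mem_true {i : ℕ} {C : Finset Lit} (hC : C ∈ famU0 n x y) (hi : (i, true) ∈ C) :
    C = {(i - 1, false), (i, true)} ∧ 2 ≤ i ∨ C = {(1, true), (x, true)} ∧ (i = 1 ∨ i = x) := by
  rcases mem_famU0.1 hC with ⟨j, h1, h2, rfl⟩ | rfl | rfl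
  · simp at hi
    subst hi
    exact Or.inl (by simpa using h1)
  · simp at hi
    exact Or.inr ⟨rfl, hi⟩
  · simp at hi

lemma ldeg_famU0_true_le {i : ℕ} :
    ldeg (famU0 n x y) (i, true) ≤ if i = x then 2 else 1 := by
  split_ifs with h
  · refine (Finset.card_le_card (t := {{(i - 1, false), (i, true)}, {(1, true), (x, true)}})
      fun C hC => ?_).trans Finset.card_le_two
    rw [Finset.mem_filter] at hC
    rcases mem_famU0_of_mem_true hC.1 hC.2 with h | h <;> simp [h.1]
  · refine Finset.card_le_one.2 fun C hC D hD => ?_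
    rw [Finset.mem_filter] at hC hD
    have hC := mem_famU0_of_mem_true hC.1 hC.2
    have hD := mem_famU0_of_mem_true hD.1 hD.2
    rcases hC with ⟨rfl, hC⟩ | ⟨rfl, hC⟩ <;> rcases hD with ⟨rfl, hD⟩ | ⟨rfl, hD⟩ <;>
      first | rfl | omega

lemma two_le_ldeg_famU0_true (hx : 2 ≤ x) (hxn : x ≤ n) : 2 ≤ ldeg (famU0 n x y) (x, true) := by
  refine Finset.one_lt_card.2 ⟨{(x - 1, false), (x, true)}, ?_, {(1, true), (x, true)}, ?_, ?_⟩
  · rw [Finset.mem_filter, mem_famU0]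
    exact ⟨Or.inl ⟨x - 1, by omega, by omega, by rw [Nat.sub_add_cancel (by omega)]⟩, by simp⟩
  · rw [Finset.mem_filter, mem_famU0]
    exact ⟨Or.inr (Or.inl rfl), by simp⟩
  · rw [Ne, pair_eq_pair_iff']
    simp

lemma ldeg_famU0_false (hx : 1 ≤ x) (hxy : x ≤ y) (hy : y ≤ n) {i : ℕ} (h1 : 1 ≤ i) (hi : i ≤ n) :
    ldeg (famU0 n x y) (i, false) =
      ldeg (famU0 n (n + 1 - y) (n + 1 - x)) (n + 1 - i, true) := by
  rw [(cnfIso_reverse hx hxy hy).ldeg_eq]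
  · simp [revLit, litMap]
  · rw [mem_litsOf, varsOf_famU0 hx hxy hy, Finset.mem_Icc]
    exact ⟨h1, hi⟩

lemma exists_vdeg_famU0_iff (hx : 2 ≤ x) (hxy : x ≤ y) (hy : y < n) :
    (∃ v ∈ varsOf (famU0 n x y), vdeg (famU0 n x y) v = 4) ↔ x = y := by
  rw [varsOf_famU0 (by omega) hxy hy.le]
  constructor
  · rintro ⟨v, hv, h4⟩
    rw [Finset.mem_Icc] at hv
    rw [vdeg, ldeg_famU0_false (by omega) hxy hy.le hv.1 hv.2] at h4
    have ht := ldeg_famU0_true_le (n := n) (x := x) (y := y) (i := v)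
    have hf := ldeg_famU0_true_le (n := n) (x := n + 1 - y) (y := n + 1 - x)
      (i := n + 1 - v)
    split_ifs at ht hf <;> omega
  · rintro rfl
    refine ⟨x, Finset.mem_Icc.2 ⟨by omega, by omega⟩, ?_⟩
    rw [vdeg, ldeg_famU0_false (by omega) le_rfl hy.le (by omega) (by omega)]
    have ht := ldeg_famU0_true_le (n := n) (x := x) (y := x) (i := x)
    have hf := ldeg_famU0_true_le (n := n) (x := n + 1 - x) (y := n + 1 - x)
      (i := n + 1 - x)
    have ht' := two_le_ldeg_famU0_true (n := n) (y := x) hx hy.le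
    have hf' := two_le_ldeg_famU0_true (n := n) (x := n + 1 - x) (y := n + 1 - x) (by omega)
      (by omega)
    rw [if_pos rfl] at ht hf
    omega

end Counting

namespace MU

variable {F : Finset (Finset Lit)}

lemma sat_of_ssubset (h : MU F) {G : Finset (Finset Lit)} (hG : G ⊂ F) : Sat G := h.2.2 G hG

/-- In a minimally unsatisfiable clause-set there are no pure literals. -/
lemma exists_mem (h : MU F) {a : Lit} (ha : a ∈ litsOf F) : ∃ C ∈ F, a ∈ C := by
  by_contra! hno
  obtain ⟨C, hC, b, hb, hba⟩ := mem_varsOf.1 (mem_litsOf.1 ha)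
  have hb : a.compl ∈ C := by
    rcases Lit.eq_or_eq_compl hba with rfl | rfl
    · exact absurd hb (hno C hC)
    · exact hb
  obtain ⟨φ, hφ⟩ := h.sat_of_ssubset
    (Finset.filter_ssubset.2 ⟨C, hC, not_not.2 hb⟩ : F.filter (fun C => a.compl ∉ C) ⊂ F)
  refine h.2.1 ⟨Function.update φ a.1 a.compl.2, fun D hD => ?_⟩
  by_cases hD' : a.compl ∈ D
  · exact ⟨a.compl, hD', LitVal_update_self φ a.compl⟩
  · obtain ⟨c, hc, hv⟩ := hφ D (Finset.mem_filter.2 ⟨hD, hD'⟩)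
    refine ⟨c, hc, ?_⟩
    rw [LitVal_update_of_ne, hv]
    intro hca
    rcases Lit.eq_or_eq_compl hca with rfl | rfl
    · exact hno D hD hc
    · exact hD' hc

lemma eq_of_subset (h : MU F) {G : Finset (Finset Lit)} (hG : G ⊆ F) (hs : ¬ Sat G) : G = F := by
  by_contra hne
  exact hs (h.sat_of_ssubset (hG.ssubset_of_ne hne))

lemma empty_notMem (h : MU F) (hne : F ≠ {∅}) : ∅ ∉ F := by
  intro h0
  refine hne (h.eq_of_subset (Finset.singleton_subset_iff.2 h0) ?_).symm
  rintro ⟨φ, hφ⟩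
  simpa using hφ ∅ (by simp)

/-- DP-reduction of a variable occurring exactly once in each polarity, together with the data
needed to undo it. -/
lemma dp (h : MU F) {C D : Finset Lit} {a : Lit} (hC : C ∈ F) (hD : D ∈ F)
    (haC : ∀ E ∈ F, a ∈ E ↔ E = C) (haD : ∀ E ∈ F, a.compl ∈ E ↔ E = D) :
    MU (insert (C.erase a ∪ D.erase a.compl) ((F.erase C).erase D)) ∧
      C.erase a ∪ D.erase a.compl ∉ (F.erase C).erase D ∧
      varsOf (insert (C.erase a ∪ D.erase a.compl) ((F.erase C).erase D)) =
        (varsOf F).erase a.1 := by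
  have haC' : a ∈ C := (haC C hC).2 rfl
  have haD' : a.compl ∈ D := (haD D hD).2 rfl
  have haD'' : a ∉ D := fun hh => h.1 D hD a hh haD'
  have haC'' : a.compl ∉ C := h.1 C hC a haC'
  have hCD : D ≠ C := fun hh => haD'' (hh ▸ haC')
  have hother : ∀ E ∈ F, E ≠ C → E ≠ D → ∀ b ∈ E, b.1 ≠ a.1 := by
    intro E hE h1 h2 b hb hba
    rcases Lit.eq_or_eq_compl hba with rfl | rfl
    · exact h1 ((haC E hE).1 hb)
    · exact h2 ((haD E hE).1 hb)
  have hCv : ∀ b ∈ C.erase a, b.1 ≠ a.1 := by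
    intro b hb hba
    rw [Finset.mem_erase] at hb
    rcases Lit.eq_or_eq_compl hba with rfl | rfl
    · exact hb.1 rfl
    · exact haC'' hb.2
  have hDv : ∀ b ∈ D.erase a.compl, b.1 ≠ a.1 := by
    intro b hb hba
    rw [Finset.mem_erase] at hb
    rcases Lit.eq_or_eq_compl hba with rfl | rfl
    · exact haD'' hb.2
    · exact hb.1 rfl
  set R := C.erase a ∪ D.erase a.compl with hR
  set F₀ := (F.erase C).erase D with hF₀
  have hmem₀ : ∀ E, E ∈ F₀ ↔ E ≠ D ∧ E ≠ C ∧ E ∈ F := by simp [hF₀]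
  -- Assignments satisfying the remaining clauses and one of the two parents extend to `F`.
  have hext : ∀ (G : Finset (Finset Lit)) (φ : ℕ → Bool), G ⊆ F →
      (∀ E ∈ G, E ≠ C → E ≠ D → ∃ b ∈ E, LitVal φ b = true) →
      (∃ b ∈ R, LitVal φ b = true) → Sat G := by
    rintro G φ hG hφ ⟨b, hb, hbv⟩
    have hb' : b ∈ C.erase a ∨ b ∈ D.erase a.compl := Finset.mem_union.1 hb
    rcases hb' with hb' | hb'
    · refine ⟨Function.update φ a.1 a.compl.2, fun E hE => ?_⟩
      by_cases h1 : E = D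
      · exact ⟨a.compl, h1 ▸ haD', LitVal_update_self φ a.compl⟩
      by_cases h2 : E = C
      · exact ⟨b, h2 ▸ (Finset.mem_erase.1 hb').2, by rwa [LitVal_update_of_ne (hCv b hb')]⟩
      obtain ⟨c, hc, hcv⟩ := hφ E hE h2 h1
      exact ⟨c, hc, by rwa [LitVal_update_of_ne (hother E (hG hE) h2 h1 c hc)]⟩
    · refine ⟨Function.update φ a.1 a.2, fun E hE => ?_⟩
      by_cases h1 : E = C
      · exact ⟨a, h1 ▸ haC', LitVal_update_self φ a⟩
      by_cases h2 : E = D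
      · exact ⟨b, h2 ▸ (Finset.mem_erase.1 hb').2, by rwa [LitVal_update_of_ne (hDv b hb')]⟩
      obtain ⟨c, hc, hcv⟩ := hφ E hE h1 h2
      exact ⟨c, hc, by rwa [LitVal_update_of_ne (hother E (hG hE) h1 h2 c hc)]⟩
  have hsat₀ : Sat F₀ := h.sat_of_ssubset <| (Finset.ssubset_iff_of_subset fun E hE =>
    ((hmem₀ E).1 hE).2.2).2 ⟨C, hC, fun hh => ((hmem₀ C).1 hh).2.1 rfl⟩
  have hunsat : ¬ Sat (insert R F₀) := by
    rintro ⟨φ, hφ⟩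
    refine h.2.1 (hext F φ subset_rfl (fun E hE h1 h2 => ?_) (hφ R (Finset.mem_insert_self _ _)))
    exact hφ E (Finset.mem_insert_of_mem ((hmem₀ E).2 ⟨h2, h1, hE⟩))
  have hRmem : R ∉ F₀ := fun hh => hunsat (by rwa [Finset.insert_eq_of_mem hh])
  have hRclause : IsClause R := by
    intro b hb hb'
    obtain ⟨φ, hφ⟩ := hsat₀
    refine h.2.1 (hext F φ subset_rfl
      (fun E hE h1 h2 => hφ E ((hmem₀ E).2 ⟨h2, h1, hE⟩)) ?_)
    by_cases hv : LitVal φ b = true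
    · exact ⟨b, hb, hv⟩
    · exact ⟨b.compl, hb', by simpa [LitVal_compl] using hv⟩
  refine ⟨⟨?_, hunsat, ?_⟩, hRmem, ?_⟩
  · intro E hE
    rcases Finset.mem_insert.1 hE with rfl | hE
    · exact hRclause
    · exact h.1 E ((hmem₀ E).1 hE).2.2
  · intro G hG
    obtain ⟨E, hE, hEG⟩ := Finset.exists_of_ssubset hG
    rcases Finset.mem_insert.1 hE with rfl | hE
    · obtain ⟨φ, hφ⟩ := hsat₀
      refine ⟨φ, fun D' hD' => hφ D' ?_⟩
      exact (Finset.mem_insert.1 (hG.1 hD')).resolve_left fun hh => hEG (hh ▸ hD')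
    · have hE' := (hmem₀ E).1 hE
      obtain ⟨φ, hφ⟩ := h.sat_of_ssubset (Finset.erase_ssubset hE'.2.2)
      refine ⟨φ, fun D' hD' => ?_⟩
      rcases Finset.mem_insert.1 (hG.1 hD') with rfl | hD''
      · obtain ⟨b, hb, hbv⟩ := hφ C (Finset.mem_erase.2 ⟨Ne.symm hE'.2.1, hC⟩)
        obtain ⟨c, hc, hcv⟩ := hφ D (Finset.mem_erase.2 ⟨Ne.symm hE'.1, hD⟩)
        by_cases hba : b = a
        · refine ⟨c, Finset.mem_union_right _ (Finset.mem_erase.2 ⟨?_, hc⟩), hcv⟩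
          rintro rfl
          rw [LitVal_compl, ← hba, hbv] at hcv
          simp at hcv
        · exact ⟨b, Finset.mem_union_left _ (Finset.mem_erase.2 ⟨hba, hb⟩), hbv⟩
      · refine hφ D' (Finset.mem_erase.2 ⟨fun hh => hEG (hh ▸ hD'), ((hmem₀ D').1 hD'').2.2⟩)
  · ext v
    rw [Finset.mem_erase, mem_varsOf, mem_varsOf]
    constructor
    · rintro ⟨E, hE, b, hb, rfl⟩
      rcases Finset.mem_insert.1 hE with rfl | hE
      · rcases Finset.mem_union.1 hb with hb | hb
        · exact ⟨hCv b hb, C, hC, b, Finset.mem_of_mem_erase hb, rfl⟩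
        · exact ⟨hDv b hb, D, hD, b, Finset.mem_of_mem_erase hb, rfl⟩
      · have hE' := (hmem₀ E).1 hE
        exact ⟨hother E hE'.2.2 hE'.2.1 hE'.1 b hb, E, hE'.2.2, b, hb, rfl⟩
    · rintro ⟨hv, E, hE, b, hb, rfl⟩
      by_cases h1 : E = C
      · subst h1
        refine ⟨R, Finset.mem_insert_self _ _, b, Finset.mem_union_left _
          (Finset.mem_erase.2 ⟨fun hh => hv (by rw [hh]), hb⟩), rfl⟩
      by_cases h2 : E = D
      · subst h2
        refine ⟨R, Finset.mem_insert_self _ _, b, Finset.mem_union_right _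
          (Finset.mem_erase.2 ⟨fun hh => hv (by rw [hh]; rfl), hb⟩), rfl⟩
      exact ⟨E, Finset.mem_insert_of_mem ((hmem₀ E).2 ⟨h2, h1, hE⟩), b, hb, rfl⟩

end MU

lemma sum_vdeg (F : Finset (Finset Lit)) : ∑ v ∈ varsOf F, vdeg F v = ∑ C ∈ F, C.card := by
  have h1 : ∑ v ∈ varsOf F, vdeg F v = ∑ a ∈ litsOf F, ldeg F a := by
    rw [litsOf, Finset.sum_product]
    simp [vdeg]
  rw [h1]
  simp only [ldeg, Finset.card_filter]
  rw [Finset.sum_comm]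
  refine Finset.sum_congr rfl fun C hC => ?_
  rw [← Finset.card_filter]
  congr 1
  ext a
  rw [Finset.mem_filter]
  exact ⟨fun h => h.2, fun h => ⟨mem_litsOf_of_mem hC h, h⟩⟩

/-- Three binary clauses over two variables are satisfiable. -/
lemma sat_of_card_varsOf_eq_two {F : Finset (Finset Lit)}
    (hv : (varsOf F).card = 2) (h2 : ∀ C ∈ F, C.card = 2) (hc : F.card ≤ 3) : Sat F := by
  obtain ⟨v, w, hvw, hvF⟩ := Finset.card_eq_two.1 hv
  let pat : Bool × Bool → Finset Lit := fun s => {(v, s.1), (w, s.2)}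
  have hpat : Function.Injective pat := by
    rintro ⟨a, b⟩ ⟨c, d⟩ h
    simp only [pat, pair_eq_pair_iff', Prod.mk.injEq, hvw, false_and, or_false, true_and] at h
    exact Prod.ext h.1 h.2
  obtain ⟨D, hD, hDF⟩ : ∃ D ∈ Finset.univ.image pat, D ∉ F :=
    Finset.exists_mem_notMem_of_card_lt_card (by
      rw [Finset.card_image_of_injective _ hpat]
      simpa [Finset.card_univ] using by omega)
  obtain ⟨⟨s, t⟩, -, rfl⟩ := Finset.mem_image.1 hD
  refine ⟨fun u => if u = v then !s else !t, fun C hC => ?_⟩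
  by_contra! hno
  refine hDF ?_
  have hsub : C ⊆ pat (s, t) := by
    rintro ⟨u, b⟩ hb
    have hu : u ∈ varsOf F := mem_varsOf.2 ⟨C, hC, _, hb, rfl⟩
    have hb' := hno _ hb
    rw [hvF, Finset.mem_insert, Finset.mem_singleton] at hu
    rcases hu with rfl | rfl
    · cases b <;> cases s <;> simp_all [LitVal, pat]
    · cases b <;> cases t <;> simp_all [LitVal, pat, Ne.symm hvw]
  have : C = pat (s, t) := Finset.eq_of_subset_of_card_le hsub
    (by rw [h2 C hC]; exact Finset.card_le_two)
  exact this ▸ hC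

namespace MU2

variable {F : Finset (Finset Lit)}

/-- A non-trivial minimally unsatisfiable 2-clause-set of deficiency 1 has a variable occurring
exactly once positively and exactly once negatively. -/
lemma exists_ldeg_eq_one (hF : MU2 F) (hd : deficiency F = 1) (hne : F ≠ {∅}) :
    ∃ v ∈ varsOf F, ldeg F (v, true) = 1 ∧ ldeg F (v, false) = 1 := by
  by_contra! hno
  have hcard : F.card = (varsOf F).card + 1 := by
    unfold deficiency at hd
    omega
  have h0 := hF.1.empty_notMem hne
  have hpos : ∀ v ∈ varsOf F, ∀ b, 1 ≤ ldeg F (v, b) := by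
    intro v hv b
    obtain ⟨C, hC, hvC⟩ := hF.1.exists_mem (mem_litsOf.2 hv : ((v, b) : Lit) ∈ litsOf F)
    exact Finset.card_pos.2 ⟨C, Finset.mem_filter.2 ⟨hC, hvC⟩⟩
  have h3 : ∀ v ∈ varsOf F, 3 ≤ vdeg F v := by
    intro v hv
    have h1 := hpos v hv true
    have h2 := hpos v hv false
    have h3 := hno v hv
    unfold vdeg
    omega
  have hs := sum_vdeg F
  have hl := Finset.card_nsmul_le_sum _ (fun v => vdeg F v) _ h3
  rw [smul_eq_mul] at hl
  have hr := Finset.sum_le_card_nsmul F (fun C => C.card) 2 hF.2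
  rw [smul_eq_mul] at hr
  have hn : (varsOf F).card = 0 ∨ (varsOf F).card = 1 ∨ (varsOf F).card = 2 := by omega
  have hvars : ∀ C ∈ F, C.card ≤ (varsOf F).card := by
    intro C hC
    refine Finset.card_le_card_of_injOn Prod.fst
      (fun a ha => mem_varsOf.2 ⟨C, hC, a, ha, rfl⟩) fun a ha b hb hab => ?_
    rcases Lit.eq_or_eq_compl hab with h | h
    · exact h
    · exact absurd (h ▸ ha) (hF.1.1 C hC b hb)
  rcases hn with hn | hn | hn
  · obtain ⟨C, hC⟩ := Finset.card_pos.1 (by omega : 0 < F.card)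
    have := hvars C hC
    rw [hn, Nat.le_zero, Finset.card_eq_zero] at this
    exact h0 (this ▸ hC)
  · have hr' := Finset.sum_le_card_nsmul F (fun C => C.card) 1 (hn ▸ hvars)
    rw [smul_eq_mul] at hr'
    omega
  · refine hF.1.2.1 (sat_of_card_varsOf_eq_two hn (fun C hC => ?_) (by omega))
    refine (Finset.sum_eq_sum_iff_of_le hF.2).1 ?_ C hC
    rw [Finset.sum_const, smul_eq_mul]
    omega

end MU2

namespace Presents

variable {F F' : Finset (Finset Lit)} {n x y : ℕ} {l : ℕ → Lit} {p : Lit}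

lemma apply_inj (h : Presents F n x y l) {i j : ℕ} (h1 : 1 ≤ i) (h2 : i ≤ n) (h3 : 1 ≤ j)
    (h4 : j ≤ n) (he : l i = l j) : i = j :=
  h.inj i j h1 h2 h3 h4 (by rw [he])

lemma apply_ne_compl (h : Presents F n x y l) {i j : ℕ} (h1 : 1 ≤ i) (h2 : i ≤ n) (h3 : 1 ≤ j)
    (h4 : j ≤ n) : l i ≠ (l j).compl := by
  intro he
  obtain rfl := h.inj i j h1 h2 h3 h4 (by rw [he]; rfl)
  exact Lit.compl_ne _ he.symm

lemma card_varsOf (h : Presents F n x y l) : (varsOf F).card = n := by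
  rw [← h.cnfIso.card_varsOf_eq, varsOf_famU0 h.one_le h.le h.le_n]
  simp

/-- Subdividing the clause `{(l i).compl, l (i + 1)}` by a new literal `p`. -/
lemma subdivide_mid (h : Presents F' n x y l) (hp : ∀ i, 1 ≤ i → i ≤ n → (l i).1 ≠ p.1)
    {i : ℕ} (hi : 1 ≤ i) (hin : i < n)
    (hF : ∀ C, C ∈ F ↔ (C ∈ F' ∧ C ≠ {(l i).compl, l (i + 1)}) ∨
      C = {(l i).compl, p} ∨ C = {p.compl, l (i + 1)}) :
    ∃ x' y' l', Presents F (n + 1) x' y' l' := by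
  obtain ⟨l', hl', hlt, heq, hgt⟩ : ∃ l' : ℕ → Lit,
      (∀ j, l' j = if j ≤ i then l j else if j = i + 1 then p else l (j - 1)) ∧
      (∀ j, j ≤ i → l' j = l j) ∧ l' (i + 1) = p ∧ (∀ j, i < j → l' (j + 1) = l j) := by
    refine ⟨fun j => if j ≤ i then l j else if j = i + 1 then p else l (j - 1),
      fun j => rfl, fun j hj => if_pos hj, by simp, fun j hj => ?_⟩
    have h1 : ¬ j + 1 ≤ i := by omega
    have h2 : ¬ j = i := by omega
    simp [h1, h2]
  have hx := h.one_le
  have hxy := h.le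
  have hy := h.le_n
  have hshift : ∀ k, l' (if k ≤ i then k else k + 1) = l k := by
    intro k
    split_ifs with hk
    · exact hlt k hk
    · exact hgt k (by omega)
  refine ⟨if x ≤ i then x else x + 1, if y ≤ i then y else y + 1, l',
    by split_ifs <;> omega, by split_ifs <;> omega, by split_ifs <;> omega, ?_, ?_⟩
  · intro j k h1 h2 h3 h4 he
    rw [hl', hl'] at he
    split_ifs at he
    · exact h.inj _ _ h1 (by omega) h3 (by omega) he
    · exact absurd he (hp _ h1 (by omega))
    · have := h.inj _ _ h1 (by omega) (by omega) (by omega) he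
      omega
    · exact absurd he.symm (hp _ h3 (by omega))
    · omega
    · exact absurd he.symm (hp _ (by omega) (by omega))
    · have := h.inj _ _ (by omega) (by omega) h3 (by omega) he
      omega
    · exact absurd he (hp _ (by omega) (by omega))
    · have := h.inj _ _ (by omega) (by omega) (by omega) (by omega) he
      omega
  · intro C
    rw [hshift, hshift, hlt 1 hi, hgt n hin, hF, h.mem_iff]
    constructor
    · rintro (⟨⟨j, h1, h2, rfl⟩ | rfl | rfl, hC⟩ | rfl | rfl)
      · refine Or.inl ?_
        rcases lt_trichotomy j i with hj | rfl | hj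
        · exact ⟨j, h1, by omega, by rw [hlt j hj.le, hlt (j + 1) hj]⟩
        · exact absurd rfl hC
        · exact ⟨j + 1, by omega, by omega, by rw [hgt j hj, hgt (j + 1) (by omega)]⟩
      · exact Or.inr (Or.inl rfl)
      · exact Or.inr (Or.inr rfl)
      · exact Or.inl ⟨i, hi, by omega, by rw [hlt i le_rfl, heq]⟩
      · exact Or.inl ⟨i + 1, by omega, by omega, by rw [heq, hgt (i + 1) (by omega)]⟩
    · rintro (⟨j, h1, h2, rfl⟩ | rfl | rfl)
      · rcases lt_trichotomy j i with hj | rfl | hj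
        · rw [hlt j hj.le, hlt (j + 1) hj]
          refine Or.inl ⟨Or.inl ⟨j, h1, by omega, rfl⟩, ?_⟩
          rw [Ne, pair_eq_pair_iff', Lit.compl_inj]
          rintro (⟨he, -⟩ | ⟨he, -⟩)
          · have := h.apply_inj h1 (by omega) hi (by omega) he
            omega
          · exact h.apply_ne_compl (by omega) (by omega) h1 (by omega) he.symm
        · exact Or.inr (Or.inl (by rw [hlt j le_rfl, heq]))
        · rcases eq_or_lt_of_le (Nat.succ_le_of_lt hj) with rfl | hj
          · exact Or.inr (Or.inr (by rw [← Nat.succ_eq_add_one, heq, hgt _ (by omega)]))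
          · obtain ⟨j, rfl⟩ : ∃ k, j = k + 1 := ⟨j - 1, by omega⟩
            rw [hgt j (by omega), hgt (j + 1) (by omega)]
            refine Or.inl ⟨Or.inl ⟨j, by omega, by omega, rfl⟩, ?_⟩
            rw [Ne, pair_eq_pair_iff', Lit.compl_inj]
            rintro (⟨he, -⟩ | ⟨he, -⟩)
            · have := h.apply_inj (by omega) (by omega) hi (by omega) he
              omega
            · exact h.apply_ne_compl (by omega) (by omega) (by omega) (by omega) he.symm
      · refine Or.inl ⟨Or.inr (Or.inl rfl), ?_⟩
        rw [Ne, pair_eq_pair_iff']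
        rintro (⟨he, -⟩ | ⟨-, he⟩)
        · exact h.apply_ne_compl (by omega) (by omega) (by omega) (by omega) he
        · exact h.apply_ne_compl (by omega) (by omega) (by omega) (by omega) he
      · refine Or.inl ⟨Or.inr (Or.inr rfl), ?_⟩
        rw [Ne, pair_eq_pair_iff']
        rintro (⟨-, he⟩ | ⟨he, -⟩)
        · exact h.apply_ne_compl (by omega) (by omega) (by omega) (by omega) he.symm
        · exact h.apply_ne_compl (by omega) (by omega) (by omega) (by omega) he.symm

/-- Replacing the clause `{l 1, l x}` by `{p.compl, l 1}` and a clause containing the new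
literal `p`. -/
lemma subdivide_front (h : Presents F' n x y l) (hp : ∀ i, 1 ≤ i → i ≤ n → (l i).1 ≠ p.1)
    {q : Lit} (hq : q = p ∨ ∃ i, 1 ≤ i ∧ i ≤ y ∧ q = l i)
    (hF : ∀ C, C ∈ F ↔ (C ∈ F' ∧ C ≠ {l 1, l x}) ∨ C = {p.compl, l 1} ∨ C = {p, q}) :
    ∃ x' y' l', Presents F (n + 1) x' y' l' := by
  obtain ⟨l', hl', heq, hgt⟩ : ∃ l' : ℕ → Lit,
      (∀ j, l' j = if j ≤ 1 then p else l (j - 1)) ∧ l' 1 = p ∧ ∀ j, 1 ≤ j → l' (j + 1) = l j := by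
    refine ⟨fun j => if j ≤ 1 then p else l (j - 1), fun j => rfl, by simp, fun j hj => ?_⟩
    have h1 : ¬ j = 0 := by omega
    simp [h1]
  have hx := h.one_le
  have hxy := h.le
  have hy := h.le_n
  obtain ⟨x', hx', hxy', rfl⟩ : ∃ x', 1 ≤ x' ∧ x' ≤ y + 1 ∧ q = l' x' := by
    rcases hq with rfl | ⟨i, h1, h2, rfl⟩
    · exact ⟨1, le_rfl, by omega, heq.symm⟩
    · exact ⟨i + 1, by omega, by omega, (hgt i h1).symm⟩
  refine ⟨x', y + 1, l', hx', hxy', by omega, ?_, ?_⟩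
  · intro j k h1 h2 h3 h4 he
    rw [hl', hl'] at he
    split_ifs at he
    · omega
    · exact absurd he.symm (hp _ (by omega) (by omega))
    · exact absurd he (hp _ (by omega) (by omega))
    · have := h.inj _ _ (by omega) (by omega) (by omega) (by omega) he
      omega
  · intro C
    rw [heq, hgt n (by omega), hgt y (by omega), hF, h.mem_iff]
    constructor
    · rintro (⟨⟨j, h1, h2, rfl⟩ | rfl | rfl, hC⟩ | rfl | rfl)
      · exact Or.inl ⟨j + 1, by omega, by omega, by rw [hgt j h1, hgt (j + 1) (by omega)]⟩
      · exact absurd rfl hC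
      · exact Or.inr (Or.inr rfl)
      · exact Or.inl ⟨1, le_rfl, by omega, by rw [heq, hgt 1 le_rfl]⟩
      · exact Or.inr (Or.inl rfl)
    · rintro (⟨j, h1, h2, rfl⟩ | rfl | rfl)
      · rcases h1.eq_or_lt with rfl | h1
        · exact Or.inr (Or.inl (by rw [heq, hgt 1 le_rfl]))
        · obtain ⟨j, rfl⟩ : ∃ k, j = k + 1 := ⟨j - 1, by omega⟩
          rw [hgt j (by omega), hgt (j + 1) (by omega)]
          refine Or.inl ⟨Or.inl ⟨j, by omega, by omega, rfl⟩, ?_⟩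
          rw [Ne, pair_eq_pair_iff']
          rintro (⟨he, -⟩ | ⟨he, -⟩) <;>
            exact h.apply_ne_compl (by omega) (by omega) (by omega) (by omega) he.symm
      · exact Or.inr (Or.inr rfl)
      · refine Or.inl ⟨Or.inr (Or.inr rfl), ?_⟩
        rw [Ne, pair_eq_pair_iff']
        rintro (⟨he, -⟩ | ⟨he, -⟩) <;>
          exact h.apply_ne_compl (by omega) (by omega) (by omega) (by omega) he.symm

/-- Replacing a clause `{a, b}` by `{p, a}` and `{p.compl, b}` for a new literal `p`. -/
lemma subdivide (h : Presents F' n x y l) (hp : ∀ i, 1 ≤ i → i ≤ n → (l i).1 ≠ p.1)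
    {a b : Lit} (hab : {a, b} ∈ F')
    (hF : ∀ C, C ∈ F ↔ (C ∈ F' ∧ C ≠ {a, b}) ∨ C = {p, a} ∨ C = {p.compl, b}) :
    ∃ x' y' l', Presents F (n + 1) x' y' l' := by
  have front : ∀ {x y l}, Presents F' n x y l → (∀ i, 1 ≤ i → i ≤ n → (l i).1 ≠ p.1) →
      ({a, b} : Finset Lit) = {l 1, l x} → ∃ x' y' l', Presents F (n + 1) x' y' l' := by
    intro x y l h hp he
    rcases pair_eq_pair_iff'.1 he with ⟨rfl, rfl⟩ | ⟨rfl, rfl⟩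
    · refine h.subdivide_front (p := p.compl) hp (Or.inr ⟨x, h.one_le, h.le, rfl⟩) fun C => ?_
      rw [hF, Lit.compl_compl]
    · refine h.subdivide_front (p := p) hp (Or.inr ⟨x, h.one_le, h.le, rfl⟩) fun C => ?_
      rw [hF, Finset.pair_comm (l x) (l 1), or_comm (a := C = {p, l x})]
  rcases (h.mem_iff _).1 hab with ⟨i, h1, h2, he⟩ | he | he
  · rcases pair_eq_pair_iff'.1 he with ⟨rfl, rfl⟩ | ⟨rfl, rfl⟩
    · refine h.subdivide_mid (p := p) hp h1 h2 fun C => ?_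
      rw [hF, Finset.pair_comm p]
    · refine h.subdivide_mid (p := p.compl) hp h1 h2 fun C => ?_
      rw [hF, Lit.compl_compl, Finset.pair_comm (l (i + 1)) (l i).compl,
        Finset.pair_comm p.compl, or_comm (a := C = {p, l (i + 1)})]
  · exact front h hp he
  · have h1 := h.one_le
    have h2 := h.le
    have h3 := h.le_n
    refine front h.reverse (fun i hi hin => hp _ (by omega) (by omega)) ?_
    rw [he, show n + 1 - 1 = n by omega, show n + 1 - (n + 1 - y) = y by omega]

/-- Replacing a unit-clause `{b}` by `{p}` and `{p.compl, b}` for a new literal `p`. -/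
lemma subdivide_unit (h : Presents F' n x y l) (hp : ∀ i, 1 ≤ i → i ≤ n → (l i).1 ≠ p.1)
    {b : Lit} (hb : {b} ∈ F')
    (hF : ∀ C, C ∈ F ↔ (C ∈ F' ∧ C ≠ {b}) ∨ C = {p} ∨ C = {p.compl, b}) :
    ∃ x' y' l', Presents F (n + 1) x' y' l' := by
  rw [← Finset.pair_eq_singleton] at hb
  have front : ∀ {x y l}, Presents F' n x y l → (∀ i, 1 ≤ i → i ≤ n → (l i).1 ≠ p.1) →
      ({b, b} : Finset Lit) = {l 1, l x} → ∃ x' y' l', Presents F (n + 1) x' y' l' := by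
    intro x y l h hp he
    have hb1 : b = l 1 := by
      rcases pair_eq_pair_iff'.1 he with he | he
      exacts [he.1, he.2]
    refine h.subdivide_front (p := p) hp (Or.inl rfl) fun C => ?_
    rw [hF, ← he, Finset.pair_eq_singleton b, Finset.pair_eq_singleton p, ← hb1,
      or_comm (a := C = {p})]
  have h1 := h.one_le
  have h2 := h.le
  have h3 := h.le_n
  rcases (h.mem_iff _).1 hb with ⟨i, h4, h5, he⟩ | he | he
  · exfalso
    refine h.apply_ne_compl (i := i + 1) (j := i) (by omega) (by omega) h4 (by omega) ?_
    rcases pair_eq_pair_iff'.1 he with he | he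
    exacts [he.2.symm.trans he.1, he.1.symm.trans he.2]
  · exact front h hp he
  · refine front h.reverse (fun i hi hin => hp _ (by omega) (by omega)) ?_
    rw [he, show n + 1 - 1 = n by omega, show n + 1 - (n + 1 - y) = y by omega]

end Presents

namespace MU

variable {F : Finset (Finset Lit)}

lemma presents_of_singleton (h : MU F) {a : Lit} (h1 : {a} ∈ F) (h2 : {a.compl} ∈ F) :
    Presents F 1 1 1 (fun _ => a) := by
  have hF : ({{a}, {a.compl}} : Finset (Finset Lit)) = F := by
    refine h.eq_of_subset (by simp [Finset.insert_subset_iff, h1, h2]) ?_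
    rintro ⟨φ, hφ⟩
    obtain ⟨b, hb, hbv⟩ := hφ {a} (by simp)
    obtain ⟨c, hc, hcv⟩ := hφ {a.compl} (by simp)
    rw [Finset.mem_singleton] at hb hc
    subst hb hc
    simp [LitVal_compl, hbv] at hcv
  refine ⟨le_rfl, le_rfl, le_rfl, fun i j _ _ _ _ _ => by omega, fun C => ?_⟩
  rw [← hF]
  simp only [Finset.mem_insert, Finset.mem_singleton, Finset.pair_eq_singleton, iff_or_self]
  rintro ⟨i, h1, h2, -⟩
  omega

end MU

namespace MU2

variable {F : Finset (Finset Lit)}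

lemma exists_presents (hF : MU2 F) (hd : deficiency F = 1) (hne : F ≠ {∅}) :
    ∃ n x y l, Presents F n x y l := by
  induction hn : (varsOf F).card using Nat.strong_induction_on generalizing F with
  | _ n ih =>
  obtain ⟨v, hv, hvt, hvf⟩ := hF.exists_ldeg_eq_one hd hne
  obtain ⟨a, rfl, hat, haf⟩ : ∃ a : Lit, a.1 = v ∧ ldeg F a = 1 ∧ ldeg F a.compl = 1 :=
    ⟨(v, true), rfl, hvt, hvf⟩
  obtain ⟨C, hC⟩ := Finset.card_eq_one.1 hat
  obtain ⟨D, hD⟩ := Finset.card_eq_one.1 haf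
  have hC' : ∀ E, (E ∈ F ∧ a ∈ E) ↔ E = C := fun E => by
    rw [← Finset.mem_singleton, ← hC, Finset.mem_filter]
  have hD' : ∀ E, (E ∈ F ∧ a.compl ∈ E) ↔ E = D := fun E => by
    rw [← Finset.mem_singleton, ← hD, Finset.mem_filter]
  obtain ⟨hCF, haC⟩ := (hC' C).2 rfl
  obtain ⟨hDF, haD⟩ := (hD' D).2 rfl
  have hCD : D ≠ C := fun he => hF.1.1 C hCF a haC (he ▸ haD)
  obtain ⟨hMU, hR, hvars⟩ := hF.1.dp hCF hDF
    (fun E hE => ⟨fun h => (hC' E).1 ⟨hE, h⟩, fun h => h ▸ haC⟩)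
    (fun E hE => ⟨fun h => (hD' E).1 ⟨hE, h⟩, fun h => h ▸ haD⟩)
  have hCins := Finset.insert_erase haC
  have hDins := Finset.insert_erase haD
  have hAcard : (C.erase a).card ≤ 1 := by
    rw [Finset.card_erase_of_mem haC]
    have := hF.2 C hCF
    omega
  have hBcard : (D.erase a.compl).card ≤ 1 := by
    rw [Finset.card_erase_of_mem haD]
    have := hF.2 D hDF
    omega
  generalize C.erase a = A at *
  generalize D.erase a.compl = B at *
  by_cases hAB : A = ∅ ∧ B = ∅
  · obtain ⟨rfl, rfl⟩ := hAB
    refine ⟨1, 1, 1, _, hF.1.presents_of_singleton (a := a) ?_ ?_⟩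
    · rwa [← insert_empty_eq a, hCins]
    · rwa [← insert_empty_eq a.compl, hDins]
  set F' := insert (A ∪ B) ((F.erase C).erase D) with hF'
  have hvc : (varsOf F').card + 1 = (varsOf F).card := by
    rw [hvars, Finset.card_erase_add_one hv]
  have hFc : F'.card + 1 = F.card := by
    rw [hF', Finset.card_insert_of_notMem hR,
      Finset.card_erase_add_one (Finset.mem_erase.2 ⟨hCD, hDF⟩), Finset.card_erase_add_one hCF]
  have hMU2 : MU2 F' := by
    refine ⟨hMU, fun E hE => ?_⟩
    rcases Finset.mem_insert.1 hE with rfl | hE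
    · exact (Finset.card_union_le _ _).trans (by omega)
    · exact hF.2 E (Finset.mem_of_mem_erase (Finset.mem_of_mem_erase hE))
  have hd' : deficiency F' = 1 := by
    unfold deficiency at hd ⊢
    omega
  have hRF' : A ∪ B ∈ F' := Finset.mem_insert_self _ _
  have hne' : F' ≠ {∅} := fun he => by
    rw [he, Finset.mem_singleton, Finset.union_eq_empty] at hRF'
    exact hAB hRF'
  obtain ⟨m, x, y, l, hl⟩ := ih _ (by omega) hMU2 hd' hne' rfl
  have hp : ∀ i, 1 ≤ i → i ≤ m → (l i).1 ≠ a.1 := fun i h1 h2 => by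
    have := hl.mem_varsOf_iff.2 ⟨i, h1, h2, rfl⟩
    rw [hvars] at this
    exact Finset.ne_of_mem_erase this
  have hmem : ∀ E, E ∈ F ↔ (E ∈ F' ∧ E ≠ A ∪ B) ∨ E = C ∨ E = D := by
    intro E
    rw [hF', Finset.mem_insert, Finset.mem_erase, Finset.mem_erase]
    have hRF : E = A ∪ B → E ≠ D → E ≠ C → E ∉ F := by
      rintro rfl h1 h2 h3
      exact hR (by simp [h1, h2, h3])
    constructor
    · intro hE
      tauto
    · rintro (h | rfl | rfl)
      · tauto
      · exact hCF
      · exact hDF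
  rcases Finset.card_le_one_iff_subset_singleton.1 hAcard with ⟨c, hc⟩
  rcases Finset.card_le_one_iff_subset_singleton.1 hBcard with ⟨b, hb⟩
  rw [Finset.subset_singleton_iff] at hc hb
  subst hCins hDins
  rcases hc with rfl | rfl <;> rcases hb with rfl | rfl
  · exact absurd ⟨rfl, rfl⟩ hAB
  · rw [Finset.empty_union] at hRF' hmem
    exact ⟨_, hl.subdivide_unit (p := a) hp hRF' hmem⟩
  · rw [Finset.union_empty] at hRF' hmem
    refine ⟨_, hl.subdivide_unit (p := a.compl) hp hRF' fun E => ?_⟩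
    rw [hmem, Lit.compl_compl, insert_empty_eq, or_comm (a := E = {a, c})]
  · exact ⟨_, hl.subdivide (p := a) hp hRF' hmem⟩

/-- Every non-trivial minimally unsatisfiable 2-clause-set of deficiency 1 is isomorphic to some
`famU0 n x y` in the normalized parameter range. -/
lemma exists_cnfIso (hF : MU2 F) (hd : deficiency F = 1) (hne : F ≠ {∅}) :
    ∃ x y, 1 ≤ x ∧ x ≤ y ∧ y ≤ (varsOf F).card ∧ x + y ≤ (varsOf F).card + 1 ∧
      ∃ f, CNFIso F (famU0 (varsOf F).card x y) f := by
  obtain ⟨n, x, y, l, h⟩ := hF.exists_presents hd hne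
  rw [h.card_varsOf]
  rcases le_total (x + y) (n + 1) with hs | hs
  · obtain ⟨f, hf, -⟩ := h.cnfIso.symm
    exact ⟨x, y, h.one_le, h.le, h.le_n, hs, f, hf⟩
  · have h' := h.reverse
    obtain ⟨f, hf, -⟩ := h'.cnfIso.symm
    exact ⟨_, _, h'.one_le, h'.le, h'.le_n, by omega, f, hf⟩

end MU2

theorem stmt18 (F : Finset (Finset Lit)) (hF : MU2 F) (hd : deficiency F = 1)
    (hne : F ≠ {(∅ : Finset Lit)}) :
    (∃! G, InFam G ∧ ∃ f, CNFIso F G f) ∧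
    ((∃ f, CNFIso F (famU2 ((varsOf F).card)) f) ↔ unitCount F = 2) ∧
    ((∃ i, 1 ≤ i ∧ i ≤ (varsOf F).card - 1 ∧ ∃ f, CNFIso F (famU1 ((varsOf F).card) i) f)
      ↔ unitCount F = 1) ∧
    ((∃ i, 2 ≤ i ∧ 2 * i ≤ (varsOf F).card + 1 ∧ ∃ f, CNFIso F (famU0s ((varsOf F).card) i) f)
      ↔ (unitCount F = 0 ∧ ∃ v ∈ varsOf F, vdeg F v = 4)) ∧
    ((∃ x y, 2 ≤ x ∧ x < y ∧ y ≤ (varsOf F).card - 1 ∧ x + y ≤ (varsOf F).card + 1 ∧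
        ∃ f, CNFIso F (famU0 ((varsOf F).card) x y) f)
      ↔ (unitCount F = 0 ∧ ∀ v ∈ varsOf F, vdeg F v ≠ 4)) := by
  obtain ⟨x, y, hx, hxy, hy, hs, f, hf⟩ := hF.exists_cnfIso hd hne
  simp only [famU2_eq, famU1_eq, famU0s_eq]
  have hu : unitCount F = (if x = 1 then 1 else 0) + (if y = (varsOf F).card then 1 else 0) :=
    hf.unitCount_eq.trans unitCount_famU0
  have hdeg : 2 ≤ x → y < (varsOf F).card →
      ((∃ v ∈ varsOf F, vdeg F v = 4) ↔ x = y) := fun h1 h2 =>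
    (hf.exists_vdeg_iff 4).trans (exists_vdeg_famU0_iff h1 hxy h2)
  have huniq : ∀ {x' y' : ℕ}, 1 ≤ x' → x' ≤ y' → y' ≤ (varsOf F).card →
      x' + y' ≤ (varsOf F).card + 1 → (∃ f, CNFIso F (famU0 (varsOf F).card x' y') f) →
      x = x' ∧ y = y' := by
    rintro x' y' h1 h2 h3 h4 ⟨g, hg⟩
    obtain ⟨f', hf', -⟩ := hf.symm
    exact eq_and_eq_of_cnfIso_famU0 hx hxy hy hs h1 h2 h3 h4 (hf'.trans hg)
  refine ⟨⟨famU0 (varsOf F).card x y,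
    ⟨inFam_iff.2 ⟨_, x, y, hx, hxy, hy, hs, rfl⟩, f, hf⟩, ?_⟩, ?_, ?_, ?_, ?_⟩
  · rintro G ⟨hG, g, hg⟩
    obtain ⟨n', x', y', h1, h2, h3, h4, rfl⟩ := inFam_iff.1 hG
    obtain rfl : (varsOf F).card = n' := by
      rw [hg.card_varsOf_eq, varsOf_famU0 h1 h2 h3]
      simp
    obtain ⟨rfl, rfl⟩ := huniq h1 h2 h3 h4 ⟨g, hg⟩
    rfl
  · constructor
    · intro h
      obtain ⟨rfl, rfl⟩ := huniq le_rfl (by omega) le_rfl (by omega) h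
      simpa using hu
    · intro h
      obtain ⟨rfl, hyn⟩ : x = 1 ∧ y = (varsOf F).card := by
        split_ifs at hu <;> omega
      exact ⟨f, hyn ▸ hf⟩
  · constructor
    · rintro ⟨i, h1, h2, h⟩
      obtain ⟨rfl, rfl⟩ := huniq le_rfl h1 (by omega) (by omega) h
      rw [hu, if_pos rfl, if_neg (by omega)]
    · intro h
      obtain ⟨rfl, hyn⟩ : x = 1 ∧ y ≠ (varsOf F).card := by
        split_ifs at hu <;> omega
      exact ⟨y, hxy, by omega, f, hf⟩
  · constructor
    · rintro ⟨i, h1, h2, h⟩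
      obtain ⟨rfl, rfl⟩ := huniq (by omega) le_rfl (by omega) (by omega) h
      exact ⟨by rw [hu, if_neg (by omega), if_neg (by omega)],
        (hdeg h1 (by omega)).2 rfl⟩
    · rintro ⟨h, h4⟩
      obtain ⟨hx1, hyn⟩ : x ≠ 1 ∧ y ≠ (varsOf F).card := by
        split_ifs at hu <;> omega
      obtain rfl := (hdeg (by omega) (by omega)).1 h4
      exact ⟨x, by omega, by omega, f, hf⟩
  · constructor
    · rintro ⟨x', y', h1, h2, h3, h4, h⟩
      obtain ⟨rfl, rfl⟩ := huniq (by omega) h2.le (by omega) h4 h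
      refine ⟨by rw [hu, if_neg (by omega), if_neg (by omega)], fun v hv hv4 => ?_⟩
      exact h2.ne ((hdeg h1 (by omega)).1 ⟨v, hv, hv4⟩)
    · rintro ⟨h, h4⟩
      obtain ⟨hx1, hyn⟩ : x ≠ 1 ∧ y ≠ (varsOf F).card := by
        split_ifs at hu <;> omega
      have hne : x ≠ y := fun he => by
        obtain ⟨v, hv, hv4⟩ := (hdeg (by omega) (by omega)).2 he
        exact h4 v hv hv4
      exact ⟨x, y, by omega, by omega, by omega, hs, f, hf⟩
end
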